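/- arXiv:2411.09005 — 3 statements merged into one kernel-verified Lean document; each statement's English description precedes it below -/
import Mathlib

section
/- Let 0<ν≤1, α>0, λ>0 with kλ≠α for every positive integer k. Then for every t≥0, the second factorial moment of the TFLBPwI satisfies ∑_{n=2}^{∞} n(n−1) p̄(n,t) = (2αλ/(α+λ)) ( (α+λ) E_ν(2λ t^ν) / (λ(α+2λ)) − E_ν(λ t^ν)/λ + E_ν(−α t^ν)/(α+2λ) ), the series being convergent. -/
open MeasureTheory

/-- The Mittag-Leffler function `E_ν(x) = ∑_{k≥0} x^k / Γ(kν+1)`. -/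
noncomputable def ML (ν x : ℝ) : ℝ := ∑' k : ℕ, x ^ k / Real.Gamma ((k : ℝ) * ν + 1)

/-- The state probabilities `p̄(n,t)` of the time-fractional linear birth process
with immigration (TFLBPwI). -/
noncomputable def pbar (ν α lam : ℝ) (n : ℕ) (t : ℝ) : ℝ :=
  if n = 0 then ML ν (-α * t ^ ν)
  else ∑ k ∈ Finset.Icc 1 n,
    ((n - 1).choose (k - 1) : ℝ) * (-1 : ℝ) ^ k * (α / ((k : ℝ) * lam - α)) *
      (ML ν (-((k : ℝ) * lam) * t ^ ν) - ML ν (-α * t ^ ν))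


lemma lap_int (s ε : ℝ) (hs : 0 < s) (hε : 0 < ε) :
    IntegrableOn (fun u : ℝ => u ^ (s - 1) * Real.exp (-(ε * u))) (Set.Ioi 0) := by
  have := integrableOn_rpow_mul_exp_neg_mul_rpow (p := 1) (s := s - 1) (b := ε) (by linarith) one_pos hε
  refine this.congr_fun (fun u hu => ?_) measurableSet_Ioi
  simp

lemma lap_meas (s : ℝ) (z : ℂ) (n : ℕ) : AEStronglyMeasurable
    (fun u : ℝ => (-(u:ℂ)) ^ n * (((u ^ (s - 1) : ℝ) : ℂ) * Complex.exp (-(z * u)))) (volume.restrict (Set.Ioi 0)) := by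
  apply Measurable.aestronglyMeasurable
  fun_prop

lemma lap_norm (s : ℝ) (z : ℂ) (u : ℝ) (hu : 0 < u) :
    ‖(((u ^ (s - 1) : ℝ) : ℂ) * Complex.exp (-(z * u)))‖ = u ^ (s - 1) * Real.exp (-(z.re * u)) := by
  rw [norm_mul, Complex.norm_real, Complex.norm_exp, Real.norm_of_nonneg (by positivity)]
  simp

lemma lap_deriv (s : ℝ) (hs : 0 < s) (z : ℂ) (hz : 0 < z.re) :
    DifferentiableAt ℂ (fun z : ℂ => ∫ u in Set.Ioi (0:ℝ), ((u ^ (s - 1) : ℝ) : ℂ) * Complex.exp (-(z * u))) z := by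
  have hopen : IsOpen {x : ℂ | z.re / 2 < x.re} := isOpen_lt continuous_const Complex.continuous_re
  refine (hasDerivAt_integral_of_dominated_loc_of_deriv_le (𝕜 := ℂ) (μ := volume.restrict (Set.Ioi (0:ℝ)))
    (F := fun (z : ℂ) (u : ℝ) => ((u ^ (s - 1) : ℝ) : ℂ) * Complex.exp (-(z * u)))
    (F' := fun (z : ℂ) (u : ℝ) => (-(u:ℂ)) * (((u ^ (s - 1) : ℝ) : ℂ) * Complex.exp (-(z * u))))
    (bound := fun u => u ^ ((s + 1) - 1) * Real.exp (-(z.re / 2 * u)))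
    (hopen.mem_nhds (by simp; linarith)) ?_ ?_ ?_ ?_ ?_ ?_).2.differentiableAt
  · exact Filter.Eventually.of_forall fun x => by simpa using lap_meas s x 0
  · refine (lap_int s z.re hs hz).mono' (by simpa using lap_meas s z 0) ?_
    refine (ae_restrict_iff' measurableSet_Ioi).2 (Filter.Eventually.of_forall fun u hu => ?_)
    exact (lap_norm s z u hu).le
  · simpa using lap_meas s z 1
  · refine (ae_restrict_iff' measurableSet_Ioi).2 (Filter.Eventually.of_forall fun u hu x hx => ?_)
    have hu : 0 < u := hu
    have hx : z.re / 2 < x.re := hx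
    rw [norm_mul, lap_norm s x u hu, norm_neg, Complex.norm_real, Real.norm_of_nonneg hu.le, ← mul_assoc]
    have : u * u ^ (s - 1) = u ^ (s + 1 - 1) := by
      rw [show s + 1 - 1 = 1 + (s - 1) by ring, Real.rpow_add hu, Real.rpow_one]
    rw [this]
    gcongr
  · exact lap_int (s + 1) _ (by linarith) (by linarith)
  · refine Filter.Eventually.of_forall fun u x hx => ?_
    have h : HasDerivAt (fun x : ℂ => -(x * (u:ℂ))) (-(u:ℂ)) x := by
      exact (hasDerivAt_mul_const (u:ℂ)).neg
    have := (h.cexp).const_mul ((u ^ (s - 1) : ℝ) : ℂ)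
    convert! this using 1
    ring

lemma lap_eq (s : ℝ) (hs : 0 < s) (z : ℂ) (hz : 0 < z.re) :
    ∫ u in Set.Ioi (0:ℝ), ((u ^ (s - 1) : ℝ) : ℂ) * Complex.exp (-(z * u))
      = (Real.Gamma s : ℂ) * z ^ (-(s:ℂ)) := by
  have hopen : IsOpen {x : ℂ | 0 < x.re} := isOpen_lt continuous_const Complex.continuous_re
  have hconv : Convex ℝ {x : ℂ | 0 < x.re} := convex_halfSpace_re_gt 0
  have h1 : AnalyticOnNhd ℂ (fun z : ℂ => ∫ u in Set.Ioi (0:ℝ), ((u ^ (s - 1) : ℝ) : ℂ) * Complex.exp (-(z * u)))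
      {x : ℂ | 0 < x.re} :=
    DifferentiableOn.analyticOnNhd (fun z hz => (lap_deriv s hs z hz).differentiableWithinAt) hopen
  have h2 : AnalyticOnNhd ℂ (fun z : ℂ => (Real.Gamma s : ℂ) * z ^ (-(s:ℂ))) {x : ℂ | 0 < x.re} := by
    refine DifferentiableOn.analyticOnNhd (fun z hz => DifferentiableAt.differentiableWithinAt ?_) hopen
    exact (differentiableAt_id.cpow_const (Or.inl hz)).const_mul _
  refine h1.eqOn_of_preconnected_of_frequently_eq h2 hconv.isPreconnected (z₀ := 1) (by simp) ?_ hz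
  have key : ∀ r : ℝ, 0 < r → ∫ u in Set.Ioi (0:ℝ), ((u ^ (s - 1) : ℝ) : ℂ) * Complex.exp (-((r:ℂ) * u))
      = (Real.Gamma s : ℂ) * (r:ℂ) ^ (-(s:ℂ)) := by
    intro r hr
    have := Real.integral_rpow_mul_exp_neg_mul_Ioi hs hr
    have h3 : ∫ u in Set.Ioi (0:ℝ), ((u ^ (s - 1) : ℝ) : ℂ) * Complex.exp (-((r:ℂ) * u))
      = ((∫ u in Set.Ioi (0:ℝ), u ^ (s - 1) * Real.exp (-(r * u)) : ℝ) : ℂ) := by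
      rw [← integral_complex_ofReal]
      congr 1; ext u; push_cast; rfl
    rw [h3, this, ← Complex.ofReal_neg, ← Complex.ofReal_cpow hr.le, ← Complex.ofReal_mul]
    congr 1
    rw [one_div, Real.inv_rpow hr.le, Real.rpow_neg hr.le, mul_comm]
  have ht : Filter.Tendsto (fun r : ℝ => (r : ℂ)) (nhdsWithin 1 {1}ᶜ) (nhdsWithin (1:ℂ) {1}ᶜ) := by
    refine tendsto_nhdsWithin_iff.2 ⟨?_, ?_⟩
    · exact (Complex.continuous_ofReal.tendsto' 1 1 (by simp)).mono_left nhdsWithin_le_nhds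
    · filter_upwards [self_mem_nhdsWithin] with r hr
      simpa using hr
  refine ht.frequently ?_
  apply Filter.Eventually.frequently
  filter_upwards [mem_nhdsWithin_of_mem_nhds (lt_mem_nhds (zero_lt_one (α := ℝ)))] with r hr
  exact key r hr

noncomputable def sg (c ξ : ℝ) : ℂ := (c : ℂ) + ((2 * Real.pi * ξ : ℝ) : ℂ) * Complex.I

lemma sg_re (c ξ : ℝ) : (sg c ξ).re = c := by simp [sg]
lemma sg_im (c ξ : ℝ) : (sg c ξ).im = 2 * Real.pi * ξ := by simp [sg]
lemma sg_cont (c : ℝ) : Continuous (sg c) := by unfold sg; fun_prop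
lemma sg_le (c ξ : ℝ) : c ≤ ‖sg c ξ‖ := by
  have := Complex.re_le_norm (sg c ξ); rwa [sg_re] at this
lemma sg_ne (c ξ : ℝ) (hc : 1 ≤ c) : sg c ξ ≠ 0 := by
  intro h; have := sg_le c ξ; rw [h] at this; simp at this; linarith
lemma sg_le2 (c ξ : ℝ) (hc : 1 ≤ c) : (1 + ‖ξ‖) / 2 ≤ ‖sg c ξ‖ := by
  have h1 := sg_le c ξ
  have h2 := Complex.abs_im_le_norm (sg c ξ)
  rw [sg_im, abs_mul, abs_of_pos Real.two_pi_pos] at h2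
  have : |ξ| ≤ 2 * Real.pi * |ξ| := by
    have := Real.pi_gt_three
    nlinarith [abs_nonneg ξ]
  rw [Real.norm_eq_abs]; linarith

lemma sg_cpow_cont (c : ℝ) (hc : 1 ≤ c) (s : ℂ) : Continuous (fun ξ => sg c ξ ^ s) := by
  refine (sg_cont c).cpow continuous_const ?_
  intro ξ; left; rw [sg_re]; linarith

lemma sg_int (c s : ℝ) (hc : 1 ≤ c) (hs : 1 < s) : Integrable (fun ξ => ‖sg c ξ‖ ^ (-s)) := by
  have h := (integrable_one_add_norm (E := ℝ) (μ := volume) (r := s) (by simpa using hs)).const_mul ((1/2:ℝ) ^ (-s))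
  refine h.mono' ?_ (Filter.Eventually.of_forall fun ξ => ?_)
  · refine Continuous.aestronglyMeasurable ?_
    refine (sg_cont c).norm.rpow_const (fun ξ => Or.inl ?_)
    simpa using sg_ne c ξ hc
  · have h0 : 0 < ‖sg c ξ‖ := by simpa using sg_ne c ξ hc
    rw [Real.norm_of_nonneg (by positivity), ← Real.mul_rpow (by norm_num) (by positivity)]
    apply Real.rpow_le_rpow_of_nonpos (by positivity) _ (by linarith)
    have := sg_le2 c ξ hc; linarith

lemma exp_sg_norm (c ξ : ℝ) : ‖Complex.exp (sg c ξ)‖ = Real.exp c := by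
  rw [Complex.norm_exp, sg_re]

open FourierTransform in
lemma inv_gamma (c s : ℝ) (hc : 1 ≤ c) (hs : 1 < s) :
    ∫ ξ, Complex.exp (sg c ξ) * sg c ξ ^ (-(s:ℂ)) = ((1 / Real.Gamma s : ℝ) : ℂ) := by
  set g : ℝ → ℂ := (Set.Ioi (0:ℝ)).indicator
    (fun u => ((u ^ (s - 1) : ℝ) : ℂ) * Complex.exp (-((c:ℂ) * u))) with hg
  have hgi : Integrable g := by
    rw [hg, integrable_indicator_iff measurableSet_Ioi]
    refine (lap_int s c (by linarith) (by linarith)).mono' (by simpa using lap_meas s c 0) ?_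
    refine (ae_restrict_iff' measurableSet_Ioi).2 (Filter.Eventually.of_forall fun u hu => ?_)
    exact (lap_norm s c u hu).le
  have hF : 𝓕 g = fun ξ => (Real.Gamma s : ℂ) * sg c ξ ^ (-(s:ℂ)) := by
    ext ξ
    rw [Real.fourier_real_eq_integral_exp_smul, ← lap_eq s (by linarith) _ (by rw [sg_re]; linarith),
      ← integral_indicator measurableSet_Ioi]
    congr 1; ext u
    rw [hg]
    by_cases hu : u ∈ Set.Ioi (0:ℝ)
    · rw [Set.indicator_of_mem hu, Set.indicator_of_mem hu, smul_eq_mul, mul_left_comm, ← Complex.exp_add]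
      congr 2
      simp only [sg]; push_cast; ring
    · rw [Set.indicator_of_notMem hu, Set.indicator_of_notMem hu, smul_zero]
  have hFi : Integrable (𝓕 g) := by
    rw [hF]
    refine Integrable.const_mul ?_ _
    refine (sg_int c s hc hs).mono' (sg_cpow_cont c hc _).aestronglyMeasurable
      (Filter.Eventually.of_forall fun ξ => ?_)
    rw [← Complex.ofReal_neg, Complex.norm_cpow_real]
  have hcont : ContinuousAt g 1 := by
    have : g =ᶠ[nhds 1] (fun u => ((u ^ (s - 1) : ℝ) : ℂ) * Complex.exp (-((c:ℂ) * u))) := by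
      filter_upwards [Ioi_mem_nhds (zero_lt_one (α := ℝ))] with u hu
      rw [hg, Set.indicator_of_mem hu]
    refine ContinuousAt.congr ?_ this.symm
    refine ContinuousAt.mul ?_ (by fun_prop)
    exact Complex.continuous_ofReal.continuousAt.comp (Real.continuousAt_rpow_const _ _ (Or.inl one_ne_zero))
  have h := hgi.fourierInv_fourier_eq hFi hcont
  rw [Real.fourierInv_eq', hF, hg, Set.indicator_of_mem (by simp)] at h
  have hG : (Real.Gamma s : ℂ) ≠ 0 := by
    exact_mod_cast (Real.Gamma_pos_of_pos (by linarith)).ne'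
  have h5 : ∫ ξ, Complex.exp (sg c ξ) * sg c ξ ^ (-(s:ℂ)) = Complex.exp c * (1 / (Real.Gamma s : ℂ)) *
     ∫ (v : ℝ), Complex.exp (↑(2 * Real.pi * inner ℝ v 1) * Complex.I) • ((Real.Gamma s : ℂ) * sg c v ^ (-(s:ℂ))) := by
    rw [← integral_const_mul]
    congr 1; ext ξ
    have : Complex.exp (sg c ξ) = Complex.exp c * Complex.exp (↑(2 * Real.pi * ξ) * Complex.I) := by
      rw [← Complex.exp_add]; rfl
    rw [this]
    simp only [smul_eq_mul]
    rw [show inner ℝ ξ (1:ℝ) = ξ by simp]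
    field_simp
  rw [h5, h]
  simp only [Real.one_rpow, Complex.ofReal_one, one_mul, mul_one, Complex.ofReal_div]
  rw [mul_right_comm, ← Complex.exp_add]; simp

noncomputable def ww (ν c ξ : ℝ) : ℂ := sg c ξ ^ (ν : ℂ)

lemma ww_cont (ν c : ℝ) (hc : 1 ≤ c) : Continuous (ww ν c) := sg_cpow_cont c hc _

lemma ww_norm (ν c ξ : ℝ) : ‖ww ν c ξ‖ = ‖sg c ξ‖ ^ ν := by
  rw [ww, Complex.norm_cpow_real]

lemma ww_re (ν c ξ : ℝ) (hν0 : 0 < ν) (hν1 : ν ≤ 1) (hc : 1 ≤ c) : c ^ ν ≤ (ww ν c ξ).re := by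
  have hne := sg_ne c ξ hc
  set θ := (sg c ξ).arg with hθ
  have habs : |θ| ≤ Real.pi / 2 := by
    rw [hθ, Complex.abs_arg_le_pi_div_two_iff, sg_re]; linarith
  have hre : (ww ν c ξ).re = ‖sg c ξ‖ ^ ν * Real.cos (ν * θ) := by
    rw [ww, Complex.cpow_ofReal, Complex.re_ofReal_mul]
    rw [Complex.add_re, Complex.ofReal_re, Complex.re_ofReal_mul, Complex.I_re, mul_zero, add_zero, mul_comm ν θ]
  have hc2 : ‖sg c ξ‖ * Real.cos θ = c := by rw [hθ, Complex.norm_mul_cos_arg, sg_re]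
  have hcos : 0 ≤ Real.cos θ := Real.cos_nonneg_of_mem_Icc (abs_le.1 habs)
  have h1 : Real.cos θ ^ ν ≤ ν * Real.cos θ + (1 - ν) * 1 := by
    have := Real.geom_mean_le_arith_mean2_weighted (w₁ := ν) (w₂ := 1 - ν) (p₁ := Real.cos θ) (p₂ := 1)
      hν0.le (by linarith) hcos zero_le_one (by ring)
    simpa using this
  have h2 : ν * Real.cos θ + (1 - ν) * 1 ≤ Real.cos (ν * θ) := by
    have h0 : (0:ℝ) ∈ Set.Icc (-(Real.pi / 2)) (Real.pi / 2) :=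
      ⟨by linarith [Real.pi_pos], by linarith [Real.pi_pos]⟩
    have h1ν : 0 ≤ 1 - ν := by linarith
    have := strictConcaveOn_cos_Icc.concaveOn.2 (abs_le.1 habs) h0 hν0.le h1ν (by ring)
    simpa using this
  rw [hre]
  calc c ^ ν = ‖sg c ξ‖ ^ ν * Real.cos θ ^ ν := by
        rw [← Real.mul_rpow (norm_nonneg _) hcos, hc2]
    _ ≤ _ := by gcongr; linarith

section
variable (ν c : ℝ) (hν0 : 0 < ν) (hν1 : ν ≤ 1) (hc : 1 ≤ c)
include hν0 hν1 hc

lemma cnu_pos : 0 < c ^ ν := by positivity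

lemma ww_norm_ge (ξ : ℝ) : c ^ ν ≤ ‖ww ν c ξ‖ :=
  (ww_re ν c ξ hν0 hν1 hc).trans (Complex.re_le_norm _)

lemma ww_ne (ξ : ℝ) : ww ν c ξ ≠ 0 := by
  have := ww_norm_ge ν c hν0 hν1 hc ξ
  have h2 := cnu_pos ν c hν0 hν1 hc
  exact norm_pos_iff.1 (by linarith)

lemma wx_ge (ξ δ : ℝ) (x : ℂ) (hδ : δ ≤ c ^ ν + x.re) : δ ≤ ‖ww ν c ξ + x‖ := by
  have := ww_re ν c ξ hν0 hν1 hc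
  have h2 := Complex.re_le_norm (ww ν c ξ + x)
  rw [Complex.add_re] at h2
  linarith

lemma wx_ne (ξ : ℝ) (x : ℂ) (hδ : 0 < c ^ ν + x.re) : ww ν c ξ + x ≠ 0 :=
  norm_pos_iff.1 (hδ.trans_le (wx_ge ν c hν0 hν1 hc ξ _ x le_rfl))

lemma wx_bd (ξ δ : ℝ) (x : ℂ) (h0 : 0 < δ) (hδ : δ ≤ c ^ ν + x.re) :
    ‖ww ν c ξ‖ ≤ (1 + ‖x‖ / δ) * ‖ww ν c ξ + x‖ := by
  have h := wx_ge ν c hν0 hν1 hc ξ δ x hδ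
  have h1 : ‖ww ν c ξ‖ ≤ ‖ww ν c ξ + x‖ + ‖x‖ := by
    have := norm_sub_le (ww ν c ξ + x) x
    simpa using this
  have h2 : ‖x‖ ≤ ‖x‖ / δ * ‖ww ν c ξ + x‖ := by
    rw [div_mul_eq_mul_div, le_div_iff₀ h0]; gcongr
  linarith

lemma wx_inv (ξ δ : ℝ) (x : ℂ) (h0 : 0 < δ) (hδ : δ ≤ c ^ ν + x.re) :
    ‖(ww ν c ξ + x)⁻¹‖ ≤ (1 + ‖x‖ / δ) * ‖ww ν c ξ‖⁻¹ := by
  have h := wx_bd ν c hν0 hν1 hc ξ δ x h0 hδ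
  have h1 : 0 < ‖ww ν c ξ‖ := norm_pos_iff.2 (ww_ne ν c hν0 hν1 hc ξ)
  have h2 : 0 < ‖ww ν c ξ + x‖ := h0.trans_le (wx_ge ν c hν0 hν1 hc ξ δ x hδ)
  rw [norm_inv, ← div_eq_mul_inv, le_div_iff₀ h1, inv_mul_le_iff₀ h2]
  linarith

lemma base_int : Integrable (fun ξ => ‖sg c ξ‖⁻¹ * ‖ww ν c ξ‖⁻¹) := by
  refine (sg_int c (1 + ν) hc (by linarith)).congr (Filter.Eventually.of_forall fun ξ => ?_)
  have h0 : 0 < ‖sg c ξ‖ := norm_pos_iff.2 (sg_ne c ξ hc)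
  simp only [ww_norm]
  rw [Real.rpow_neg h0.le, Real.rpow_add h0, Real.rpow_one, mul_inv]

lemma wx_cont (x : ℂ) (hδ : 0 < c ^ ν + x.re) : Continuous fun ξ => (ww ν c ξ + x)⁻¹ :=
  ((ww_cont ν c hc).add continuous_const).inv₀ (fun ξ => wx_ne ν c hν0 hν1 hc ξ x hδ)

lemma sg_inv_cont : Continuous fun ξ => (sg c ξ)⁻¹ :=
  (sg_cont c).inv₀ (fun ξ => sg_ne c ξ hc)

lemma H_int (x : ℂ) (hx : 0 < c ^ ν + x.re) (C : ℂ) :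
    Integrable (fun ξ => Complex.exp (sg c ξ) * (sg c ξ)⁻¹ * (C * (ww ν c ξ + x)⁻¹)) := by
  have hcont : Continuous (fun ξ => Complex.exp (sg c ξ) * (sg c ξ)⁻¹ * (C * (ww ν c ξ + x)⁻¹)) :=
    (((sg_cont c).cexp).mul (sg_inv_cont ν c hν0 hν1 hc)).mul
      (continuous_const.mul (wx_cont ν c hν0 hν1 hc x hx))
  refine ((base_int ν c hν0 hν1 hc).const_mul (Real.exp c * ‖C‖ * (1 + ‖x‖ / (c ^ ν + x.re)))).mono'
    hcont.aestronglyMeasurable (Filter.Eventually.of_forall fun ξ => ?_)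
  have := wx_inv ν c hν0 hν1 hc ξ _ x hx le_rfl
  rw [norm_mul, norm_mul, norm_mul, exp_sg_norm, norm_inv (sg c ξ)]
  calc _ ≤ Real.exp c * ‖sg c ξ‖⁻¹ * (‖C‖ * ((1 + ‖x‖ / (c ^ ν + x.re)) * ‖ww ν c ξ‖⁻¹)) := by gcongr
    _ = _ := by ring

lemma H_diff (x : ℂ) (hx : 0 < c ^ ν + x.re) :
    DifferentiableAt ℂ (fun x : ℂ => ∫ ξ, Complex.exp (sg c ξ) * (sg c ξ)⁻¹ * (-x * (ww ν c ξ + x)⁻¹)) x := by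
  set δ := (c ^ ν + x.re) / 2 with hδ
  have hδ0 : 0 < δ := by positivity
  have hopen : IsOpen ({y : ℂ | δ < c ^ ν + y.re} ∩ {y : ℂ | ‖y‖ < ‖x‖ + 1}) :=
    (isOpen_lt continuous_const (by fun_prop)).inter (isOpen_lt (by fun_prop) continuous_const)
  set K := 1 + (‖x‖ + 1) / δ with hK
  refine (hasDerivAt_integral_of_dominated_loc_of_deriv_le (𝕜 := ℂ) (μ := volume)
    (F := fun (x : ℂ) (ξ : ℝ) => Complex.exp (sg c ξ) * (sg c ξ)⁻¹ * (-x * (ww ν c ξ + x)⁻¹))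
    (F' := fun (x : ℂ) (ξ : ℝ) => Complex.exp (sg c ξ) * (sg c ξ)⁻¹ *
      (-ww ν c ξ * ((ww ν c ξ + x)⁻¹ * (ww ν c ξ + x)⁻¹)))
    (bound := fun ξ => (Real.exp c * (K * K)) * (‖sg c ξ‖⁻¹ * ‖ww ν c ξ‖⁻¹))
    (hopen.mem_nhds ⟨by simp [hδ]; linarith, by simp⟩) ?_ ?_ ?_ ?_ ?_ ?_).2.differentiableAt
  · filter_upwards [hopen.mem_nhds (x := x) ⟨by simp [hδ]; linarith, by simp⟩] with y hy
    have hy1 : δ < c ^ ν + y.re := hy.1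
    exact (H_int ν c hν0 hν1 hc y (by linarith) (-y)).1
  · exact H_int ν c hν0 hν1 hc x hx (-x)
  · refine Continuous.aestronglyMeasurable ?_
    exact (((sg_cont c).cexp).mul (sg_inv_cont ν c hν0 hν1 hc)).mul
      ((ww_cont ν c hc).neg.mul ((wx_cont ν c hν0 hν1 hc x hx).mul (wx_cont ν c hν0 hν1 hc x hx)))
  · refine Filter.Eventually.of_forall fun ξ y hy => ?_
    have hy1 : δ < c ^ ν + y.re := hy.1
    have hy2 : ‖y‖ < ‖x‖ + 1 := hy.2
    have h1 : ‖(ww ν c ξ + y)⁻¹‖ ≤ K * ‖ww ν c ξ‖⁻¹ := by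
      refine (wx_inv ν c hν0 hν1 hc ξ δ y hδ0 hy1.le).trans ?_
      rw [hK]; gcongr
    have hw : 0 < ‖ww ν c ξ‖ := norm_pos_iff.2 (ww_ne ν c hν0 hν1 hc ξ)
    have hK0 : 0 < K := by positivity
    simp only [norm_mul, norm_neg]
    rw [exp_sg_norm, norm_inv (sg c ξ)]
    calc _ ≤ Real.exp c * ‖sg c ξ‖⁻¹ * (‖ww ν c ξ‖ * ((K * ‖ww ν c ξ‖⁻¹) * (K * ‖ww ν c ξ‖⁻¹))) := by gcongr
      _ = _ := by field_simp
  · exact (base_int ν c hν0 hν1 hc).const_mul _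
  · refine Filter.Eventually.of_forall fun ξ y hy => ?_
    have hy1 : δ < c ^ ν + y.re := hy.1
    have hne := wx_ne ν c hν0 hν1 hc ξ y (by linarith)
    have h1 : HasDerivAt (fun y : ℂ => ww ν c ξ + y) 1 y := (hasDerivAt_id y).const_add _
    have h2 : HasDerivAt (fun y : ℂ => -y) (-1) y := (hasDerivAt_id y).neg
    have h3 := (h2.mul (h1.inv hne)).const_mul (Complex.exp (sg c ξ) * (sg c ξ)⁻¹)
    convert! h3 using 1
    congr 1
    simp only [Pi.inv_apply]
    field_simp
    ring

lemma H_sum (x : ℂ) (hx : ‖x‖ < c ^ ν) :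
    HasSum (fun k : ℕ => (-x) ^ (k + 1) / ((Real.Gamma (((k + 1 : ℕ) : ℝ) * ν + 1) : ℝ) : ℂ))
      (∫ ξ, Complex.exp (sg c ξ) * (sg c ξ)⁻¹ * (-x * (ww ν c ξ + x)⁻¹)) := by
  have hρ := cnu_pos ν c hν0 hν1 hc
  have hre : 0 < c ^ ν + x.re := by
    have := (abs_le.1 (Complex.abs_re_le_norm x)).1; linarith
  set F : ℕ → ℝ → ℂ := fun k ξ => Complex.exp (sg c ξ) * (sg c ξ)⁻¹ * ((-x) * (ww ν c ξ)⁻¹) ^ (k + 1) with hF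
  have hFI : ∀ k, ∫ ξ, F k ξ = (-x) ^ (k + 1) / ((Real.Gamma (((k + 1 : ℕ) : ℝ) * ν + 1) : ℝ) : ℂ) := by
    intro k
    have h := inv_gamma c (((k + 1 : ℕ) : ℝ) * ν + 1) hc (by
      have : 0 < ((k + 1 : ℕ) : ℝ) * ν := by positivity
      linarith)
    rw [div_eq_mul_one_div, ← Complex.ofReal_one, ← Complex.ofReal_div, ← h, ← integral_const_mul]
    congr 1; ext ξ
    have hs := sg_ne c ξ hc
    have : sg c ξ ^ (-(((((k + 1 : ℕ) : ℝ) * ν + 1 : ℝ)) : ℂ)) = (sg c ξ)⁻¹ * ((ww ν c ξ)⁻¹) ^ (k + 1) := by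
      rw [Complex.cpow_neg, Complex.ofReal_add, Complex.cpow_add _ _ hs, Complex.ofReal_mul,
        Complex.ofReal_natCast, Complex.cpow_nat_mul, Complex.ofReal_one, Complex.cpow_one, mul_inv,
        mul_comm, inv_pow]
      rfl
    rw [this, hF]
    simp only [mul_pow]
    ring
  have hbd : ∀ k ξ, ‖F k ξ‖ ≤ (Real.exp c * ‖x‖ * (‖x‖ / c ^ ν) ^ k) * (‖sg c ξ‖⁻¹ * ‖ww ν c ξ‖⁻¹) := by
    intro k ξ
    have hw := ww_norm_ge ν c hν0 hν1 hc ξ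
    simp only [hF, norm_mul, norm_pow, norm_neg, norm_inv, exp_sg_norm]
    rw [pow_succ (‖x‖ * ‖ww ν c ξ‖⁻¹)]
    have : ‖x‖ * ‖ww ν c ξ‖⁻¹ ≤ ‖x‖ / c ^ ν := by rw [div_eq_mul_inv]; gcongr
    calc _ ≤ Real.exp c * ‖sg c ξ‖⁻¹ * ((‖x‖ / c ^ ν) ^ k * (‖x‖ * ‖ww ν c ξ‖⁻¹)) := by gcongr
      _ = _ := by ring
  have hFi : ∀ k, Integrable (F k) := by
    intro k
    refine ((base_int ν c hν0 hν1 hc).const_mul _).mono' (Continuous.aestronglyMeasurable ?_)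
      (Filter.Eventually.of_forall (hbd k))
    exact (((sg_cont c).cexp).mul (sg_inv_cont ν c hν0 hν1 hc)).mul
      ((continuous_const.mul ((ww_cont ν c hc).inv₀ (ww_ne ν c hν0 hν1 hc))).pow _)
  have hlt : ‖x‖ / c ^ ν < 1 := by rw [div_lt_one hρ]; exact hx
  have hsum : Summable fun k => ∫ ξ, ‖F k ξ‖ := by
    refine Summable.of_nonneg_of_le (fun k => integral_nonneg fun ξ => norm_nonneg _)
      (fun k => integral_mono (hFi k).norm ((base_int ν c hν0 hν1 hc).const_mul _) (hbd k)) ?_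
    simp_rw [integral_const_mul]
    exact (((summable_geometric_of_lt_one (by positivity) hlt).mul_left _).mul_right _)
  have := hasSum_integral_of_summable_integral_norm hFi hsum
  simp_rw [hFI] at this
  convert! this using 1
  congr 1; ext ξ
  have hw := ww_norm_ge ν c hν0 hν1 hc ξ
  have hw0 := ww_ne ν c hν0 hν1 hc ξ
  have hwx := wx_ne ν c hν0 hν1 hc ξ x hre
  have hr : ‖(-x) * (ww ν c ξ)⁻¹‖ < 1 := by
    rw [norm_mul, norm_neg, norm_inv, ← div_eq_mul_inv, div_lt_one (by linarith)]; linarith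
  have hg := ((hasSum_geometric_of_norm_lt_one hr).mul_left ((-x) * (ww ν c ξ)⁻¹)).mul_left
    (Complex.exp (sg c ξ) * (sg c ξ)⁻¹)
  have h7 : (fun k => F k ξ) = fun k => (Complex.exp (sg c ξ) * (sg c ξ)⁻¹) * ((-x) * (ww ν c ξ)⁻¹ * ((-x) * (ww ν c ξ)⁻¹) ^ k) := by
    ext k; simp only [hF, pow_succ']
  rw [h7, hg.tsum_eq]
  congr 1
  rw [mul_assoc]; congr 1
  have : 1 - -x * (ww ν c ξ)⁻¹ = (ww ν c ξ + x) * (ww ν c ξ)⁻¹ := by field_simp; ring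
  rw [this, mul_inv, inv_inv]; field_simp

end

noncomputable def MLc (ν : ℝ) (x : ℂ) : ℂ := ∑' k : ℕ, x ^ k / ((Real.Gamma ((k : ℝ) * ν + 1) : ℝ) : ℂ)

lemma MLc_eq_small (ν c : ℝ) (hν0 : 0 < ν) (hν1 : ν ≤ 1) (hc : 1 ≤ c) (x : ℂ) (hx : ‖x‖ < c ^ ν) :
    MLc ν (-x) = 1 + ∫ ξ, Complex.exp (sg c ξ) * (sg c ξ)⁻¹ * (-x * (ww ν c ξ + x)⁻¹) := by
  have h := H_sum ν c hν0 hν1 hc x hx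
  have h2 := (hasSum_nat_add_iff (f := fun k : ℕ => (-x) ^ k / ((Real.Gamma ((k : ℝ) * ν + 1) : ℝ) : ℂ)) 1).1 h
  rw [MLc, h2.tsum_eq]
  simp [add_comm]

lemma exists_c (ν R : ℝ) (hν0 : 0 < ν) : ∃ c : ℝ, 1 ≤ c ∧ R < c ^ ν := by
  refine ⟨(|R| + 1) ^ (1 / ν), Real.one_le_rpow (by linarith [abs_nonneg R]) (by positivity), ?_⟩
  rw [← Real.rpow_mul (by positivity), one_div_mul_cancel hν0.ne', Real.rpow_one]
  linarith [le_abs_self R]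

lemma MLc_diff (ν : ℝ) (hν0 : 0 < ν) (hν1 : ν ≤ 1) (x : ℂ) : DifferentiableAt ℂ (fun x => MLc ν (-x)) x := by
  obtain ⟨c, hc, hR⟩ := exists_c ν ‖x‖ hν0
  have hre : 0 < c ^ ν + x.re := by
    have := (abs_le.1 (Complex.abs_re_le_norm x)).1; linarith
  refine ((H_diff ν c hν0 hν1 hc x hre).const_add 1).congr_of_eventuallyEq ?_
  filter_upwards [(isOpen_lt continuous_norm continuous_const).mem_nhds hR] with y hy
  exact MLc_eq_small ν c hν0 hν1 hc y hy

lemma MLc_eq (ν c : ℝ) (hν0 : 0 < ν) (hν1 : ν ≤ 1) (hc : 1 ≤ c) (x : ℂ) (hx : 0 < c ^ ν + x.re) :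
    MLc ν (-x) = 1 + ∫ ξ, Complex.exp (sg c ξ) * (sg c ξ)⁻¹ * (-x * (ww ν c ξ + x)⁻¹) := by
  have hset : {x : ℂ | 0 < c ^ ν + x.re} = {x : ℂ | -(c ^ ν) < x.re} := by
    ext y; simp only [Set.mem_ofPred_eq]; constructor <;> intro h <;> linarith
  have hopen : IsOpen {x : ℂ | 0 < c ^ ν + x.re} := isOpen_lt continuous_const (by fun_prop)
  have hpre : IsPreconnected {x : ℂ | 0 < c ^ ν + x.re} := by
    rw [hset]; exact (convex_halfSpace_re_gt _).isPreconnected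
  have h1 : AnalyticOnNhd ℂ (fun x => MLc ν (-x)) {x : ℂ | 0 < c ^ ν + x.re} :=
    DifferentiableOn.analyticOnNhd (fun z hz => (MLc_diff ν hν0 hν1 z).differentiableWithinAt) hopen
  have h2 : AnalyticOnNhd ℂ (fun x : ℂ => 1 + ∫ ξ, Complex.exp (sg c ξ) * (sg c ξ)⁻¹ * (-x * (ww ν c ξ + x)⁻¹))
      {x : ℂ | 0 < c ^ ν + x.re} :=
    DifferentiableOn.analyticOnNhd
      (fun z hz => ((H_diff ν c hν0 hν1 hc z hz).const_add 1).differentiableWithinAt) hopen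
  have hρ := cnu_pos ν c hν0 hν1 hc
  refine h1.eqOn_of_preconnected_of_eventuallyEq h2 hpre (z₀ := 0) (by simpa using hρ) ?_ hx
  filter_upwards [(isOpen_lt continuous_norm continuous_const).mem_nhds
    (show (0:ℂ) ∈ {y : ℂ | ‖y‖ < c ^ ν} by simpa using hρ)] with y hy
  exact MLc_eq_small ν c hν0 hν1 hc y hy

noncomputable def Bm (l : ℝ) : ℕ → ℂ → ℂ
  | 0, w => (w + l)⁻¹
  | m + 1, w => Bm l m w * (((m + 1 : ℕ) : ℂ) * l * (w + ((m + 2 : ℕ) : ℂ) * l)⁻¹)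

lemma ne_of_re {z : ℂ} (h : 0 < z.re) : z ≠ 0 := by
  intro h0; rw [h0] at h; simp at h

lemma re_wk (l : ℝ) (w : ℂ) (k : ℕ) : (w + (k : ℂ) * l).re = w.re + k * l := by
  simp

lemma Bm_diff (l : ℝ) (hl : 0 < l) (m : ℕ) : ∀ w : ℂ, 0 < w.re →
    Bm l m (w + l) = Bm l m w * (w + l) * (w + ((m + 2 : ℕ) : ℂ) * l)⁻¹ := by
  induction m with
  | zero =>
    intro w hw
    have h1 : w + l ≠ 0 := ne_of_re (by simp; linarith)
    simp only [Bm]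
    rw [inv_mul_cancel₀ h1, one_mul]
    congr 1; push_cast; ring
  | succ m ih =>
    intro w hw
    have h2 : w + ((m + 2 : ℕ) : ℂ) * l ≠ 0 := ne_of_re (by rw [re_wk]; positivity)
    simp only [Bm]
    rw [ih w hw]
    have : w + l + ((m + 2 : ℕ) : ℂ) * l = w + ((m + 1 + 2 : ℕ) : ℂ) * l := by push_cast; ring
    rw [this]
    ring

lemma Bm_fwd (l : ℝ) (hl : 0 < l) (m : ℕ) : ∀ w : ℂ, 0 < w.re →
    (fwdDiff (l:ℂ))^[m] (fun z : ℂ => z⁻¹) (w + l) = (-1) ^ m * Bm l m w := by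
  induction m with
  | zero => intro w hw; simp [Bm]
  | succ m ih =>
    intro w hw
    have h2 : w + ((m + 2 : ℕ) : ℂ) * l ≠ 0 := ne_of_re (by rw [re_wk]; positivity)
    rw [Function.iterate_succ_apply', fwdDiff, ih w hw, ih (w + l) (by simp; linarith), Bm_diff l hl m w hw, Bm]
    rw [pow_succ]
    have : Bm l m w = Bm l m w * (w + ((m + 2 : ℕ) : ℂ) * l) * (w + ((m + 2 : ℕ) : ℂ) * l)⁻¹ := by
      field_simp
    conv_lhs => rw [sub_eq_add_neg]; rhs; rw [this]
    push_cast
    ring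

lemma Bm_sum (l : ℝ) (hl : 0 < l) (m : ℕ) (w : ℂ) (hw : 0 < w.re) :
    ∑ j ∈ Finset.range (m + 1), (m.choose j : ℂ) * (-1) ^ j * (w + (((j + 1 : ℕ) : ℝ) * l : ℝ))⁻¹ = Bm l m w := by
  have h := Bm_fwd l hl m w hw
  rw [fwdDiff_iter_eq_sum_shift] at h
  have h1 : Bm l m w = (-1) ^ m * ((-1) ^ m * Bm l m w) := by
    rw [← mul_assoc, ← mul_pow]; simp
  rw [h1, ← h, Finset.mul_sum]
  refine Finset.sum_congr rfl fun j hj => ?_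
  have hj' : j ≤ m := by simpa [Nat.lt_succ_iff] using hj
  have h3 : (-1 : ℂ) ^ m * (-1) ^ (m - j) = (-1) ^ j := by
    obtain ⟨d, rfl⟩ := Nat.exists_eq_add_of_le hj'
    rw [Nat.add_sub_cancel_left, pow_add, mul_assoc, ← mul_pow]; simp
  rw [zsmul_eq_mul, nsmul_eq_mul]
  push_cast
  rw [← h3, show w + (l:ℂ) + (j:ℂ) * l = w + ((j:ℂ) + 1) * l by ring]
  ring

lemma Bm_bd (l : ℝ) (hl : 0 < l) (w : ℂ) (hw : 3 * l ≤ w.re) (m : ℕ) :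
    ‖Bm l m w‖ ≤ ‖(w + l)⁻¹‖ * (24 / (((m:ℝ) + 1) * (m + 2) * (m + 3) * (m + 4))) := by
  induction m with
  | zero => simp [Bm]; norm_num
  | succ m ih =>
    have h1 : ((m:ℝ) + 5) * l ≤ ‖w + ((m + 2 : ℕ) : ℂ) * l‖ := by
      refine le_trans ?_ (Complex.re_le_norm _)
      rw [re_wk]; push_cast; linarith
    have h2 : ‖((m + 1 : ℕ) : ℂ) * l * (w + ((m + 2 : ℕ) : ℂ) * l)⁻¹‖ ≤ ((m:ℝ) + 1) / (m + 5) := by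
      rw [norm_mul, norm_mul, norm_inv, Complex.norm_natCast, Complex.norm_real, Real.norm_of_nonneg hl.le]
      have : ((m:ℝ) + 1) / (m + 5) = ((m + 1 : ℕ) : ℝ) * l * (((m:ℝ) + 5) * l)⁻¹ := by
        push_cast; field_simp
      rw [this]; gcongr
    rw [Bm, norm_mul]
    calc _ ≤ (‖(w + l)⁻¹‖ * (24 / (((m:ℝ) + 1) * (m + 2) * (m + 3) * (m + 4)))) * (((m:ℝ) + 1) / (m + 5)) := by gcongr
      _ = _ := by push_cast; field_simp; ring

lemma Bm_bd2 (l : ℝ) (hl : 0 < l) (w : ℂ) (hw : 3 * l ≤ w.re) (m : ℕ) :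
    ‖((m:ℂ) + 1) * m * Bm l m w‖ ≤ ‖(w + l)⁻¹‖ * (24 * (1 / ((m + 1 : ℕ) : ℝ) ^ 2)) := by
  have h := Bm_bd l hl w hw m
  rw [norm_mul, norm_mul, Complex.norm_natCast, show (m:ℂ) + 1 = ((m + 1 : ℕ) : ℂ) by push_cast; ring,
    Complex.norm_natCast]
  calc _ ≤ ((m + 1 : ℕ) : ℝ) * m * (‖(w + l)⁻¹‖ * (24 / (((m:ℝ) + 1) * (m + 2) * (m + 3) * (m + 4)))) := by gcongr
    _ = ‖(w + l)⁻¹‖ * (((m + 1 : ℕ) : ℝ) * m * (24 / (((m:ℝ) + 1) * (m + 2) * (m + 3) * (m + 4)))) := by ring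
    _ ≤ _ := by
      gcongr ?_ * ?_
      push_cast
      rw [mul_div_assoc', mul_one_div, div_le_div_iff₀ (by positivity) (by positivity)]
      have : (0:ℝ) ≤ m := by positivity
      nlinarith [pow_nonneg this 2, pow_nonneg this 3, pow_nonneg this 4]

lemma summ24 : Summable fun m : ℕ => (24 * (1 / ((m + 1 : ℕ) : ℝ) ^ 2)) :=
  (((summable_nat_add_iff 1).2 (Real.summable_one_div_nat_pow.2 one_lt_two))).mul_left 24

lemma Bm_hasSum (l : ℝ) (hl : 0 < l) (w : ℂ) (hw : 3 * l ≤ w.re) :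
    HasSum (fun m : ℕ => ((m:ℂ) + 1) * m * Bm l m w)
      (2 * ((w + ((-2 * l : ℝ) : ℂ))⁻¹ - (w + ((-l : ℝ) : ℂ))⁻¹)) := by
  have hs : Summable (fun m : ℕ => ((m:ℂ) + 1) * m * Bm l m w) :=
    Summable.of_norm_bounded (summ24.mul_left _) (Bm_bd2 l hl w hw)
  rw [hs.hasSum_iff_tendsto_nat]
  have h2 : w - 2 * l ≠ 0 := ne_of_re (by simp; linarith)
  have h1 : w - l ≠ 0 := ne_of_re (by simp; linarith)
  have h0 : w + l ≠ 0 := ne_of_re (by simp; linarith)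
  set A : ℂ := 1 / (w - 2 * l) with hA
  set B : ℂ := (w + l) / ((w - l) * (w - 2 * l)) with hB
  set C : ℂ := 2 * l / ((w - l) * (w - 2 * l)) with hC
  have hCe : 2 * ((w + ((-2 * l : ℝ) : ℂ))⁻¹ - (w + ((-l : ℝ) : ℂ))⁻¹) = C := by
    push_cast
    rw [show w + -2 * (l:ℂ) = w - 2 * l by ring, show w + -(l:ℂ) = w - l by ring, hC]
    field_simp; ring
  rw [hCe]
  have hpart : ∀ N : ℕ, ∑ m ∈ Finset.range N, ((m:ℂ) + 1) * m * Bm l m w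
      = C - (w + ((N : ℂ) + 1) * l) * (A * N ^ 2 + B * N + C) * Bm l N w := by
    intro N
    induction N with
    | zero => simp [Bm]; field_simp; simp
    | succ N ih =>
      have h3 : w + ((N + 2 : ℕ) : ℂ) * l ≠ 0 := ne_of_re (by rw [re_wk]; have : 0 < w.re := by linarith
                                                              positivity)
      rw [Finset.sum_range_succ, ih, Bm]
      have h4 : (w + (((N + 1 : ℕ) : ℂ) + 1) * l) = w + ((N + 2 : ℕ) : ℂ) * l := by push_cast; ring
      rw [h4]
      have h5 : ∀ X Y Z : ℂ, (w + ((N + 2 : ℕ) : ℂ) * l) * X * (Y * (Z * (w + ((N + 2 : ℕ) : ℂ) * l)⁻¹)) = X * Y * Z := by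
        intro X Y Z; field_simp
      rw [h5]
      have h6 : ((N:ℂ) + 1) * N = (w + ((N : ℂ) + 1) * l) * (A * N ^ 2 + B * N + C)
          - (A * ((N + 1 : ℕ) : ℂ) ^ 2 + B * ((N + 1 : ℕ) : ℂ) + C) * (((N + 1 : ℕ) : ℂ) * l) := by
        have ea : (w - 2 * l) * A = 1 := by rw [hA]; field_simp
        have hB' : (w - l) * B = (w + l) * A := by rw [hA, hB]; field_simp
        have hC' : (w - l) * C = 2 * l * A := by rw [hA, hC]; field_simp
        have eb : (w - l) * B - 3 * l * A = 1 := by rw [hB']; linear_combination ea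
        have ec : w * C - l * (A + B) = 0 := by
          refine (mul_eq_zero.1 ?_).resolve_left h1
          linear_combination w * hC' - l * hB'
        push_cast
        linear_combination (-(N:ℂ) ^ 2) * ea - N * eb - ec
      rw [h6]; ring
  simp_rw [hpart]
  suffices h : Filter.Tendsto (fun N : ℕ => (w + ((N : ℂ) + 1) * l) * (A * N ^ 2 + B * N + C) * Bm l N w)
      Filter.atTop (nhds 0) by simpa using tendsto_const_nhds.sub h
  set D := (‖w‖ + l) * (‖A‖ + ‖B‖ + ‖C‖) * ‖(w + l)⁻¹‖ * 24 with hD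
  have hlim : Filter.Tendsto (fun N : ℕ => D * (1 / ((N:ℝ) + 1))) Filter.atTop (nhds 0) := by
    simpa using tendsto_one_div_add_atTop_nhds_zero_nat.const_mul D
  refine squeeze_zero_norm (fun N => ?_) hlim
  have hN : (0:ℝ) ≤ N := by positivity
  have e1 : ‖w + ((N : ℂ) + 1) * l‖ ≤ (‖w‖ + l) * (N + 1) := by
    refine (norm_add_le _ _).trans ?_
    rw [norm_mul, show (N:ℂ) + 1 = ((N + 1 : ℕ) : ℂ) by push_cast; ring, Complex.norm_natCast,
      Complex.norm_real, Real.norm_of_nonneg hl.le]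
    push_cast
    nlinarith [norm_nonneg w]
  have e2 : ‖A * N ^ 2 + B * N + C‖ ≤ (‖A‖ + ‖B‖ + ‖C‖) * (N + 1) ^ 2 := by
    refine (norm_add₃_le).trans ?_
    simp only [norm_mul, norm_pow, Complex.norm_natCast]
    have : (N:ℝ) ^ 2 ≤ (N + 1) ^ 2 := by gcongr; linarith
    have : (N:ℝ) ≤ (N + 1) ^ 2 := by nlinarith
    have : (1:ℝ) ≤ (N + 1) ^ 2 := by nlinarith
    nlinarith [norm_nonneg A, norm_nonneg B, norm_nonneg C,
      mul_le_mul_of_nonneg_left ‹(N:ℝ) ^ 2 ≤ (N + 1) ^ 2› (norm_nonneg A),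
      mul_le_mul_of_nonneg_left ‹(N:ℝ) ≤ (N + 1) ^ 2› (norm_nonneg B),
      mul_le_mul_of_nonneg_left ‹(1:ℝ) ≤ (N + 1) ^ 2› (norm_nonneg C)]
  have e3 : ‖Bm l N w‖ ≤ ‖(w + l)⁻¹‖ * (24 / ((N:ℝ) + 1) ^ 4) := by
    refine (Bm_bd l hl w hw N).trans ?_
    have : ((N:ℝ) + 1) ^ 4 ≤ ((N:ℝ) + 1) * (N + 2) * (N + 3) * (N + 4) := by
      calc ((N:ℝ) + 1) ^ 4 = ((N:ℝ) + 1) * (N + 1) * (N + 1) * (N + 1) := by ring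
        _ ≤ _ := by gcongr <;> norm_num
    gcongr
  rw [norm_mul, norm_mul]
  calc _ ≤ ((‖w‖ + l) * (N + 1)) * ((‖A‖ + ‖B‖ + ‖C‖) * (N + 1) ^ 2) * (‖(w + l)⁻¹‖ * (24 / ((N:ℝ) + 1) ^ 4)) := by
        gcongr
    _ = _ := by rw [hD]; field_simp

lemma ML_ofReal (ν x : ℝ) : ((ML ν x : ℝ) : ℂ) = MLc ν x := by
  rw [ML, MLc, Complex.ofReal_tsum]
  congr 1; ext k; push_cast; rfl

noncomputable def Af (ν c a ξ : ℝ) : ℂ :=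
  Complex.exp (sg c ξ) * (sg c ξ)⁻¹ * (a * (ww ν c ξ) * (ww ν c ξ + (a:ℂ))⁻¹)

section
variable (ν c : ℝ) (hν0 : 0 < ν) (hν1 : ν ≤ 1) (hc : 1 ≤ c)
include hν0 hν1 hc

lemma Af_cont (a : ℝ) (ha : 0 < a) : Continuous (Af ν c a) := by
  have := cnu_pos ν c hν0 hν1 hc
  exact (((sg_cont c).cexp).mul (sg_inv_cont ν c hν0 hν1 hc)).mul
      ((continuous_const.mul (ww_cont ν c hc)).mul (wx_cont ν c hν0 hν1 hc a (by simp; linarith)))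

lemma Af_bd (a : ℝ) (ha : 0 < a) (ξ : ℝ) : ‖Af ν c a ξ‖ ≤ Real.exp c * a * (1 + a / (c ^ ν + a)) * ‖sg c ξ‖⁻¹ := by
  have hρ := cnu_pos ν c hν0 hν1 hc
  have h := wx_inv ν c hν0 hν1 hc ξ (c ^ ν + a) a (by linarith) (by simp)
  have hw : 0 < ‖ww ν c ξ‖ := norm_pos_iff.2 (ww_ne ν c hν0 hν1 hc ξ)
  rw [Complex.norm_real, Real.norm_of_nonneg ha.le] at h
  simp only [Af, norm_mul, exp_sg_norm, norm_inv (sg c ξ), Complex.norm_real, Real.norm_of_nonneg ha.le]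
  calc _ ≤ Real.exp c * ‖sg c ξ‖⁻¹ * (a * ‖ww ν c ξ‖ * ((1 + a / (c ^ ν + a)) * ‖ww ν c ξ‖⁻¹)) := by gcongr
    _ = _ := by field_simp

lemma Q_int (a x : ℝ) (ha : 0 < a) (hx : 0 < c ^ ν + x) :
    Integrable (fun ξ => Af ν c a ξ * (ww ν c ξ + (x:ℂ))⁻¹) := by
  refine ((base_int ν c hν0 hν1 hc).const_mul
    (Real.exp c * a * (1 + a / (c ^ ν + a)) * (1 + ‖(x:ℂ)‖ / (c ^ ν + x)))).mono'
    ((Af_cont ν c hν0 hν1 hc a ha).mul (wx_cont ν c hν0 hν1 hc x (by simpa using hx))).aestronglyMeasurable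
    (Filter.Eventually.of_forall fun ξ => ?_)
  have hρ := cnu_pos ν c hν0 hν1 hc
  have h1 := Af_bd ν c hν0 hν1 hc a ha ξ
  have h2 := wx_inv ν c hν0 hν1 hc ξ _ x hx (by simp)
  rw [norm_mul]
  calc _ ≤ (Real.exp c * a * (1 + a / (c ^ ν + a)) * ‖sg c ξ‖⁻¹) * ((1 + ‖(x:ℂ)‖ / (c ^ ν + x)) * ‖ww ν c ξ‖⁻¹) := by
        gcongr
    _ = _ := by ring

lemma Q_eq (a x : ℝ) (ha : 0 < a) (hx : 0 < c ^ ν + x) (hxa : x ≠ a) :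
    ∫ ξ, Af ν c a ξ * (ww ν c ξ + (x:ℂ))⁻¹ = -((a / (x - a) * (ML ν (-x) - ML ν (-a)) : ℝ) : ℂ) := by
  have hρ := cnu_pos ν c hν0 hν1 hc
  have hx' : 0 < c ^ ν + (x:ℂ).re := by simpa using hx
  have ha' : 0 < c ^ ν + (a:ℂ).re := by simp; linarith
  have h1 := MLc_eq ν c hν0 hν1 hc x hx'
  have h2 := MLc_eq ν c hν0 hν1 hc a ha'
  push_cast
  rw [ML_ofReal, ML_ofReal, Complex.ofReal_neg, Complex.ofReal_neg, h1, h2, add_sub_add_left_eq_sub,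
    ← integral_sub (H_int ν c hν0 hν1 hc x hx' _) (H_int ν c hν0 hν1 hc a ha' _), ← integral_const_mul,
    ← integral_neg]
  congr 1; ext ξ
  have n1 := wx_ne ν c hν0 hν1 hc ξ x hx'
  have n2 := wx_ne ν c hν0 hν1 hc ξ a ha'
  have n3 : (x:ℂ) - a ≠ 0 := by rw [sub_ne_zero]; exact_mod_cast hxa
  have n4 := sg_ne c ξ hc
  simp only [Af]
  field_simp
  ring

end

lemma core (ν a l : ℝ) (hν0 : 0 < ν) (hν1 : ν ≤ 1) (ha : 0 < a) (hl : 0 < l)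
    (hne : ∀ k : ℕ, 1 ≤ k → (k:ℝ) * l ≠ a) :
    HasSum (fun m : ℕ => ((m:ℝ) + 1) * m * ∑ j ∈ Finset.range (m + 1),
      (m.choose j : ℝ) * (-1) ^ (j + 1) * (a / (((j + 1 : ℕ) : ℝ) * l - a) *
        (ML ν (-(((j + 1 : ℕ) : ℝ) * l)) - ML ν (-a))))
      (2 * (a / (-l - a) * (ML ν (-(-l)) - ML ν (-a)) - a / (-2 * l - a) * (ML ν (-(-2 * l)) - ML ν (-a)))) := by
  obtain ⟨c, hc, hR⟩ := exists_c ν (3 * l) hν0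
  have hρ := cnu_pos ν c hν0 hν1 hc
  have hwre : ∀ ξ, 3 * l ≤ (ww ν c ξ).re := fun ξ => hR.le.trans (ww_re ν c ξ hν0 hν1 hc)
  set F : ℕ → ℝ → ℂ := fun m ξ => Af ν c a ξ * (((m:ℂ) + 1) * m * Bm l m (ww ν c ξ)) with hF
  have hFeq : ∀ m, F m = fun ξ => ∑ j ∈ Finset.range (m + 1), (((m:ℂ) + 1) * m * ((m.choose j : ℂ) * (-1) ^ j)) *
      (Af ν c a ξ * (ww ν c ξ + (((j + 1 : ℕ) : ℝ) * l : ℝ))⁻¹) := by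
    intro m; ext ξ
    simp only [hF]
    rw [← Bm_sum l hl m _ (by linarith [hwre ξ]), Finset.mul_sum, Finset.mul_sum]
    refine Finset.sum_congr rfl fun j hj => ?_
    ring
  have hpos : ∀ j : ℕ, 0 < c ^ ν + (((j + 1 : ℕ) : ℝ) * l : ℝ) := fun j => by positivity
  have hFi : ∀ m, Integrable (F m) := by
    intro m
    rw [hFeq]
    exact integrable_finsetSum _ fun j hj => (Q_int ν c hν0 hν1 hc a _ ha (hpos j)).const_mul _
  have hFI : ∀ m, ∫ ξ, F m ξ = ((((m:ℝ) + 1) * m * ∑ j ∈ Finset.range (m + 1),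
      (m.choose j : ℝ) * (-1) ^ (j + 1) * (a / (((j + 1 : ℕ) : ℝ) * l - a) *
        (ML ν (-(((j + 1 : ℕ) : ℝ) * l)) - ML ν (-a))) : ℝ) : ℂ) := by
    intro m
    rw [hFeq, integral_finsetSum _ fun j hj => (Q_int ν c hν0 hν1 hc a _ ha (hpos j)).const_mul _]
    rw [Complex.ofReal_mul, Complex.ofReal_sum, Finset.mul_sum]
    refine Finset.sum_congr rfl fun j hj => ?_
    rw [integral_const_mul, Q_eq ν c hν0 hν1 hc a _ ha (hpos j) (hne (j + 1) (by omega))]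
    rw [Complex.ofReal_mul (_ * _) (_ * _)]
    push_cast
    ring
  set K := Real.exp c * a * (1 + a / (c ^ ν + a)) * (1 + ‖(l:ℂ)‖ / (c ^ ν + l)) with hK
  have hbd : ∀ m ξ, ‖F m ξ‖ ≤ (K * (24 * (1 / ((m + 1 : ℕ) : ℝ) ^ 2))) * (‖sg c ξ‖⁻¹ * ‖ww ν c ξ‖⁻¹) := by
    intro m ξ
    have h1 := Af_bd ν c hν0 hν1 hc a ha ξ
    have h2 := wx_inv ν c hν0 hν1 hc ξ (c ^ ν + l) l (by positivity) (by simp)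
    have h3 := Bm_bd2 l hl _ (hwre ξ) m
    simp only [hF]
    rw [norm_mul]
    calc _ ≤ (Real.exp c * a * (1 + a / (c ^ ν + a)) * ‖sg c ξ‖⁻¹) *
          (((1 + ‖(l:ℂ)‖ / (c ^ ν + l)) * ‖ww ν c ξ‖⁻¹) * (24 * (1 / ((m + 1 : ℕ) : ℝ) ^ 2))) := by
            refine mul_le_mul h1 (h3.trans ?_) (norm_nonneg _) (by positivity)
            gcongr
      _ = _ := by rw [hK]; ring
  have hsum : Summable fun m => ∫ ξ, ‖F m ξ‖ := by
    refine Summable.of_nonneg_of_le (fun k => integral_nonneg fun ξ => norm_nonneg _)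
      (fun k => integral_mono (hFi k).norm ((base_int ν c hν0 hν1 hc).const_mul _) (hbd k)) ?_
    simp_rw [integral_const_mul]
    exact (summ24.mul_left _).mul_right _
  have hmain := hasSum_integral_of_summable_integral_norm hFi hsum
  simp_rw [hFI] at hmain
  have hlim : ∫ ξ, ∑' m, F m ξ = ((2 * (a / (-l - a) * (ML ν (-(-l)) - ML ν (-a)) - a / (-2 * l - a) * (ML ν (-(-2 * l)) - ML ν (-a))) : ℝ) : ℂ) := by
    have i1 := Q_int ν c hν0 hν1 hc a (-l) ha (by linarith)
    have i2 := Q_int ν c hν0 hν1 hc a (-2 * l) ha (by linarith)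
    have e1 := Q_eq ν c hν0 hν1 hc a (-l) ha (by linarith) (by linarith)
    have e2 := Q_eq ν c hν0 hν1 hc a (-2 * l) ha (by linarith) (by linarith)
    have : (fun ξ => ∑' m, F m ξ) = fun ξ => 2 * (Af ν c a ξ * (ww ν c ξ + ((-2 * l : ℝ):ℂ))⁻¹
        - Af ν c a ξ * (ww ν c ξ + ((-l : ℝ):ℂ))⁻¹) := by
      ext ξ
      simp only [hF]
      rw [((Bm_hasSum l hl _ (hwre ξ)).mul_left _).tsum_eq]
      ring
    rw [this, integral_const_mul, integral_sub i2 i1, e1, e2]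
    push_cast; ring
  rw [hlim] at hmain
  exact_mod_cast hmain

theorem pbar_second_factorial_moment (ν α lam : ℝ) (hν0 : 0 < ν) (hν1 : ν ≤ 1)
    (hα : 0 < α) (hlam : 0 < lam) (hne : ∀ k : ℕ, 1 ≤ k → (k : ℝ) * lam ≠ α)
    (t : ℝ) (ht : 0 ≤ t) :
    HasSum (fun n : ℕ => (n : ℝ) * ((n : ℝ) - 1) * pbar ν α lam n t)
      ((2 * α * lam / (α + lam)) *
        ((α + lam) * ML ν (2 * lam * t ^ ν) / (lam * (α + 2 * lam))
          - ML ν (lam * t ^ ν) / lam + ML ν (-α * t ^ ν) / (α + 2 * lam))) := by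
  have hsh : ∀ m : ℕ, pbar ν α lam (m + 1) t = ∑ j ∈ Finset.range (m + 1),
      (m.choose j : ℝ) * (-1) ^ (j + 1) * (α / (((j + 1 : ℕ) : ℝ) * lam - α) *
        (ML ν (-(((j + 1 : ℕ) : ℝ) * lam) * t ^ ν) - ML ν (-α * t ^ ν))) := by
    intro m
    have e := Finset.sum_Ico_add' (fun k : ℕ => (m.choose (k - 1) : ℝ) * (-1) ^ k * (α / ((k : ℝ) * lam - α) *
        (ML ν (-((k : ℝ) * lam) * t ^ ν) - ML ν (-α * t ^ ν)))) 0 (m + 1) 1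
    simp only [Nat.add_sub_cancel] at e
    rw [pbar, if_neg (Nat.succ_ne_zero m), Finset.range_eq_Ico, e]
    refine Finset.sum_congr ?_ fun k hk => ?_
    · ext k; simp
    · simp only [Nat.add_sub_cancel]; ring
  rcases ht.eq_or_lt with rfl | htpos
  · rw [Real.zero_rpow hν0.ne'] at hsh ⊢
    have hz : (fun n : ℕ => (n : ℝ) * ((n : ℝ) - 1) * pbar ν α lam n 0) = fun _ => 0 := by
      ext n
      cases n with
      | zero => simp
      | succ m => rw [hsh m]; simp
    rw [hz]
    convert! hasSum_zero using 1
    simp only [mul_zero]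
    field_simp
    ring
  · set T := t ^ ν with hT
    have hT0 : 0 < T := Real.rpow_pos_of_pos htpos ν
    have h := core ν (α * T) (lam * T) hν0 hν1 (by positivity) (by positivity) (by
      intro k hk h
      apply hne k hk
      have : ((k:ℝ) * lam) * T = α * T := by linarith
      exact mul_right_cancel₀ hT0.ne' this)
    rw [← hasSum_nat_add_iff' 1]
    convert! h using 1
    · ext m
      rw [hsh m]
      push_cast
      rw [add_sub_cancel_right]
      congr 1
      refine Finset.sum_congr rfl fun j hj => ?_
      have e : α * T / (((j:ℝ) + 1) * (lam * T) - α * T) = α / (((j:ℝ) + 1) * lam - α) := by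
        rw [show ((j:ℝ) + 1) * (lam * T) - α * T = (((j:ℝ) + 1) * lam - α) * T by ring,
          mul_div_mul_right _ _ hT0.ne']
      rw [e, show -(((j:ℝ) + 1) * lam) * T = -(((j:ℝ) + 1) * (lam * T)) by ring, neg_mul α T]
    · have e1 : α * T / (-(lam * T) - α * T) = -(α / (α + lam)) := by
        rw [show -(lam * T) - α * T = -(α + lam) * T by ring, mul_div_mul_right _ _ hT0.ne', div_neg]
      have e2 : α * T / (-2 * (lam * T) - α * T) = -(α / (α + 2 * lam)) := by
        rw [show -2 * (lam * T) - α * T = -(α + 2 * lam) * T by ring, mul_div_mul_right _ _ hT0.ne', div_neg]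
      rw [e1, e2, neg_neg, show -(-2 * (lam * T)) = 2 * lam * T by ring, neg_mul α T]
      simp
      field_simp
      ring
end

section
/- Let 0<ν≤1, α>0, λ>0 with kλ≠α for every positive integer k. Then for every t≥0, the variance of the TFLBPwI, defined as Var(t) = ∑_{n=1}^∞ n² p̄(n,t) − (∑_{n=1}^∞ n p̄(n,t))², equals 2α E_ν(2λ t^ν)/(α+2λ) − α E_ν(λ t^ν)/(α+λ) − α² E_ν(−α t^ν)/((α+λ)(α+2λ)) − (α/(α+λ))² ( E_ν(λ t^ν) − E_ν(−α t^ν) )². -/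
open MeasureTheory

open Filter Topology

lemma gamma_ineq (y a : ℝ) (hy : 1 < y) (ha : 0 ≤ a) :
    Real.Gamma y * (y-1)^a ≤ Real.Gamma (y+a) := by
  rcases ha.eq_or_lt with rfl | ha
  · simp
  have h := Real.convexOn_log_Gamma.slope_mono_adjacent (x := y-1) (y := y) (z := y+a)
    (by simp; linarith) (by simp; linarith) (by linarith) (by linarith)
  have hy1 : 0 < y - 1 := by linarith
  have hg : Real.Gamma y = (y-1) * Real.Gamma (y-1) := by
    have := Real.Gamma_add_one hy1.ne'
    simpa using this
  have hp : 0 < Real.Gamma (y-1) := Real.Gamma_pos_of_pos hy1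
  have hp2 : 0 < Real.Gamma y := Real.Gamma_pos_of_pos (by linarith)
  have hp3 : 0 < Real.Gamma (y+a) := Real.Gamma_pos_of_pos (by linarith)
  have hl : Real.log (Real.Gamma y) = Real.log (y-1) + Real.log (Real.Gamma (y-1)) := by
    rw [hg, Real.log_mul hy1.ne' hp.ne']
  simp only [Function.comp] at h
  have e1 : y - (y-1) = 1 := by ring
  have e2 : y + a - y = a := by ring
  rw [e1, e2, div_one, le_div_iff₀ ha] at h
  rw [← Real.log_le_log_iff (by positivity) hp3, Real.log_mul hp2.ne' (by positivity),
    Real.log_rpow hy1]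
  nlinarith

lemma ml_summable (ν : ℝ) (hν : 0 < ν) (x : ℝ) :
    Summable (fun k : ℕ => x ^ k / Real.Gamma ((k : ℝ) * ν + 1)) := by
  by_cases hx : x = 0
  · subst hx
    apply summable_of_ne_finset_zero (s := {0})
    intro b hb
    simp at hb
    simp [hb]
  have hpos : ∀ k : ℕ, 0 < Real.Gamma ((k : ℝ) * ν + 1) := fun k =>
    Real.Gamma_pos_of_pos (by positivity)
  have hlim : Filter.Tendsto (fun k : ℕ => |x| / ((k : ℝ) * ν) ^ ν) Filter.atTop (nhds 0) := by
    apply Filter.Tendsto.div_atTop tendsto_const_nhds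
    exact (tendsto_rpow_atTop hν).comp
      (tendsto_natCast_atTop_atTop.atTop_mul_const hν)
  apply summable_of_ratio_norm_eventually_le (r := 1/2) (by norm_num)
  filter_upwards [hlim.eventually_lt_const (show (0:ℝ) < 1/2 by norm_num),
    Filter.eventually_gt_atTop 0] with k hk hk0
  have hk0' : (0:ℝ) < k * ν := by positivity
  have hG := gamma_ineq ((k:ℝ) * ν + 1) ν (by linarith) hν.le
  have e : ((k:ℝ) * ν + 1 - 1) = k * ν := by ring
  rw [e] at hG
  have e2 : (((k+1 : ℕ) : ℝ) * ν + 1) = (k:ℝ) * ν + 1 + ν := by push_cast; ring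
  have hP : 0 < ((k:ℝ) * ν)^ν := by positivity
  rw [div_lt_iff₀ hP] at hk
  rw [norm_div, norm_div, Real.norm_of_nonneg (hpos k).le, Real.norm_of_nonneg (hpos _).le, e2,
    norm_pow, norm_pow, Real.norm_eq_abs, pow_succ, div_le_iff₀ (e2 ▸ hpos (k+1))]
  calc |x|^k * |x| ≤ |x|^k * (1/2 * ((k:ℝ) * ν)^ν) := by gcongr
    _ = 1/2 * (|x|^k / Real.Gamma ((k:ℝ) * ν + 1)) * (Real.Gamma ((k:ℝ) * ν + 1) * ((k:ℝ) * ν)^ν) := by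
        have := (hpos k).ne'
        field_simp
    _ ≤ _ := by
        have := hpos k
        gcongr
lemma gprod (s : ℝ) (hs : 0 < s) (N : ℕ) :
    ∏ j ∈ Finset.range N, (s + j) = Real.Gamma (s + N) / Real.Gamma s := by
  have h0 := (Real.Gamma_pos_of_pos hs).ne'
  induction N with
  | zero => simp [h0]
  | succ n ih =>
    rw [Finset.prod_range_succ, ih]
    have : s + ((n+1 : ℕ):ℝ) = s + n + 1 := by push_cast; ring
    rw [this, Real.Gamma_add_one (by positivity)]
    ring

/-- scaled moments -/
noncomputable def mom (ν : ℝ) (N k : ℕ) : ℝ :=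
  ∏ j ∈ Finset.range (N+1), (ν * k + 1 + j) / ((k:ℝ) + 1 + j)

lemma mom_bound (ν : ℝ) (hν : 0 < ν) (hν1 : ν ≤ 1) (N k : ℕ) :
    ((N:ℝ) ^ (1-ν)) ^ k * mom ν N k / k.factorial ≤ 1 / Real.Gamma ((k:ℝ) * ν + 1) := by
  rw [mom, Finset.prod_div_distrib, gprod _ (by positivity), gprod _ (by positivity),
    Real.Gamma_nat_eq_factorial k]
  have h := gamma_ineq (ν * k + 1 + (N+1:ℕ)) (k * (1-ν)) (by push_cast; have : 0 ≤ ν * k := by positivity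
                                                             linarith) (by have : 0 ≤ 1 - ν := by linarith
                                                                           positivity)
  have e : ν * k + 1 + (N+1:ℕ) + k * (1-ν) = k + 1 + (N+1:ℕ) := by ring
  rw [e] at h
  have hG1 : 0 < Real.Gamma ((k:ℝ) + 1 + (N+1:ℕ)) := Real.Gamma_pos_of_pos (by positivity)
  have hG2 : 0 < Real.Gamma (ν * k + 1) := Real.Gamma_pos_of_pos (by positivity)
  have hG3 : 0 < Real.Gamma (ν * k + 1 + (N+1:ℕ)) := Real.Gamma_pos_of_pos (by positivity)
  have e3 : ((N:ℝ) ^ (1-ν)) ^ k = (N:ℝ) ^ ((k:ℝ) * (1-ν)) := by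
    rw [← Real.rpow_natCast, ← Real.rpow_mul (by positivity)]; ring_nf
  have h4 : (N:ℝ) ^ ((k:ℝ) * (1-ν)) ≤ (ν * k + 1 + (N+1:ℕ) - 1) ^ ((k:ℝ) * (1-ν)) := by
    apply Real.rpow_le_rpow (by positivity)
    · push_cast
      have : 0 ≤ ν * k := by positivity
      linarith
    · have : 0 ≤ 1 - ν := by linarith
      positivity
  have hf : (0:ℝ) < k.factorial := by positivity
  rw [e3, mul_comm (k:ℝ) ν]
  have h5 := (mul_le_mul_of_nonneg_left h4 hG3.le).trans h
  have h6 : (N:ℝ) ^ ((k:ℝ) * (1-ν)) * (Real.Gamma (ν * k + 1 + (N+1:ℕ)) / Real.Gamma (ν * k + 1) /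
      (Real.Gamma ((k:ℝ) + 1 + (N+1:ℕ)) / k.factorial)) / k.factorial
      = (Real.Gamma (ν * k + 1 + (N+1:ℕ)) * (N:ℝ) ^ ((k:ℝ) * (1-ν)) / Real.Gamma ((k:ℝ) + 1 + (N+1:ℕ))) * (1 / Real.Gamma (ν * k + 1)) := by
    field_simp
  rw [h6]
  have : Real.Gamma (ν * k + 1 + (N+1:ℕ)) * (N:ℝ) ^ ((k:ℝ) * (1-ν)) / Real.Gamma ((k:ℝ) + 1 + (N+1:ℕ)) ≤ 1 := by
    rw [div_le_one hG1]; exact h5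
  exact mul_le_of_le_one_left (by positivity) this

lemma mom_tendsto (ν : ℝ) (hν : 0 < ν) (k : ℕ) :
    Tendsto (fun N : ℕ => ((N:ℝ) ^ (1-ν)) ^ k * mom ν N k / k.factorial) atTop
      (𝓝 (1 / Real.Gamma ((k:ℝ) * ν + 1))) := by
  have h1 := Real.GammaSeq_tendsto_Gamma ((k:ℝ)+1)
  have h2 := Real.GammaSeq_tendsto_Gamma ((k:ℝ) * ν+1)
  have hG2 : 0 < Real.Gamma (k * ν + 1) := Real.Gamma_pos_of_pos (by positivity)
  have h3 := (h1.div h2 hG2.ne').div_const (k.factorial : ℝ)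
  have hf : (k.factorial:ℝ) ≠ 0 := by positivity
  rw [Real.Gamma_nat_eq_factorial k] at h3
  have e : (k.factorial : ℝ) / Real.Gamma ((k:ℝ) * ν + 1) / k.factorial = 1 / Real.Gamma ((k:ℝ) * ν + 1) := by
    field_simp
  rw [e] at h3
  refine h3.congr' ?_
  filter_upwards [eventually_gt_atTop 0] with N hN
  have hN' : (0:ℝ) < N := by exact_mod_cast hN
  simp only [Pi.div_apply, Real.GammaSeq]
  congr 1
  rw [mom, Finset.prod_div_distrib]
  have e3 : ((N:ℝ) ^ (1-ν)) ^ k = (N:ℝ) ^ ((k:ℝ)+1) / (N:ℝ) ^ ((k:ℝ)*ν+1) := by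
    rw [← Real.rpow_natCast, ← Real.rpow_mul (by positivity), ← Real.rpow_sub hN']; ring_nf
  rw [e3, mul_comm ν]
  have p1 : (∏ j ∈ Finset.range (N+1), ((k:ℝ) + 1 + j)) ≠ 0 :=
    Finset.prod_ne_zero_iff.2 fun j _ => by positivity
  have p2 : (∏ j ∈ Finset.range (N+1), ((k:ℝ) * ν + 1 + j)) ≠ 0 :=
    Finset.prod_ne_zero_iff.2 fun j _ => by positivity
  have p3 : (N:ℝ) ^ ((k:ℝ)*ν+1) ≠ 0 := by positivity
  have p4 : (N.factorial:ℝ) ≠ 0 := by positivity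
  field_simp


lemma rho_exists (ν : ℝ) (hν : 0 < ν) (hν1 : ν ≤ 1) (j : ℕ) :
    ∃ ρ : Measure ℝ, IsProbabilityMeasure ρ ∧ (∀ᵐ u ∂ρ, u ∈ Set.Icc (0:ℝ) 1) ∧
      ∀ k : ℕ, ∫ u, u ^ k ∂ρ = (ν * k + 1 + j) / ((k:ℝ) + 1 + j) := by
  let κ : Measure ℝ := volume.restrict (Set.Ioc (0:ℝ) 1)
  have hκ : IsProbabilityMeasure κ := ⟨by simp [κ]⟩
  have hm : Measurable (fun v : ℝ => v ^ (1 / ((j:ℝ)+1))) := by fun_prop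
  let κ' := κ.map (fun v : ℝ => v ^ (1 / ((j:ℝ)+1)))
  have hκ' : IsProbabilityMeasure κ' := Measure.isProbabilityMeasure_map hm.aemeasurable
  have hs : MeasurableSet {u : ℝ | u ∈ Set.Icc (0:ℝ) 1} := measurableSet_Icc
  have hae : ∀ᵐ u ∂κ', u ∈ Set.Icc (0:ℝ) 1 := by
    rw [ae_map_iff hm.aemeasurable hs]
    refine (ae_restrict_iff' measurableSet_Ioc).2 (Eventually.of_forall fun v hv => ?_)
    exact ⟨Real.rpow_nonneg hv.1.le _, Real.rpow_le_one hv.1.le hv.2 (by positivity)⟩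
  have hint : ∀ k : ℕ, Integrable (fun u : ℝ => u ^ k) κ' := fun k => by
    refine Integrable.of_bound (C := 1) (by fun_prop) ?_
    filter_upwards [hae] with u hu
    rw [norm_pow, Real.norm_of_nonneg hu.1]
    exact pow_le_one₀ hu.1 hu.2
  refine ⟨ENNReal.ofReal ν • Measure.dirac 1 + ENNReal.ofReal (1-ν) • κ', ⟨?_⟩, ?_, ?_⟩
  · simp only [Measure.coe_add, Measure.coe_smul, Pi.add_apply, Pi.smul_apply, measure_univ,
      smul_eq_mul, mul_one]
    rw [← ENNReal.ofReal_add hν.le (by linarith)]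
    simp
  · rw [ae_add_measure_iff]
    constructor
    · apply Measure.ae_smul_measure
      rw [ae_dirac_iff hs]
      simp
    · exact Measure.ae_smul_measure hae _
  · intro k
    rw [integral_add_measure, integral_smul_measure, integral_smul_measure, integral_dirac,
      integral_map hm.aemeasurable (by fun_prop)]
    · have e : ∫ v, (v ^ (1 / ((j:ℝ)+1))) ^ k ∂κ = ∫ v in (0:ℝ)..1, v ^ ((k:ℝ) / ((j:ℝ)+1)) := by
        rw [intervalIntegral.integral_of_le zero_le_one]
        refine setIntegral_congr_fun measurableSet_Ioc fun v hv => ?_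
        rw [← Real.rpow_natCast, ← Real.rpow_mul hv.1.le]
        congr 1; ring
      have hh : (0:ℝ) ≤ (k:ℝ) / ((j:ℝ)+1) := by positivity
      rw [e, integral_rpow (Or.inl (by linarith)), ENNReal.toReal_ofReal hν.le,
        ENNReal.toReal_ofReal (by linarith), Real.zero_rpow (by linarith)]
      simp only [one_pow, smul_eq_mul, Real.one_rpow]
      field_simp
      ring
    · exact (integrable_dirac (by simp)).smul_measure (by simp)
    · exact (hint k).smul_measure (by simp)

lemma mu_exists (ν : ℝ) (hν : 0 < ν) (hν1 : ν ≤ 1) (N : ℕ) :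
    ∃ ρ : Measure ℝ, IsProbabilityMeasure ρ ∧ (∀ᵐ u ∂ρ, u ∈ Set.Icc (0:ℝ) 1) ∧
      ∀ k : ℕ, ∫ u, u ^ k ∂ρ = ∏ j ∈ Finset.range N, (ν * k + 1 + j) / ((k:ℝ) + 1 + j) := by
  have hs : MeasurableSet {u : ℝ | u ∈ Set.Icc (0:ℝ) 1} := measurableSet_Icc
  induction N with
  | zero =>
    refine ⟨Measure.dirac 1, inferInstance, ?_, ?_⟩
    · rw [ae_dirac_iff hs]; simp
    · intro k; simp
  | succ n ih =>
    obtain ⟨μ, h1, h2, h3⟩ := ih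
    obtain ⟨ρ, r1, r2, r3⟩ := rho_exists ν hν hν1 n
    have hm : Measurable (fun p : ℝ × ℝ => p.1 * p.2) := by fun_prop
    refine ⟨(μ.prod ρ).map (fun p => p.1 * p.2),
      Measure.isProbabilityMeasure_map hm.aemeasurable, ?_, ?_⟩
    · rw [ae_map_iff hm.aemeasurable hs]
      have a1 : ∀ᵐ p ∂(μ.prod ρ), p.1 ∈ Set.Icc (0:ℝ) 1 := Measure.quasiMeasurePreserving_fst.ae h2
      have a2 : ∀ᵐ p ∂(μ.prod ρ), p.2 ∈ Set.Icc (0:ℝ) 1 := Measure.quasiMeasurePreserving_snd.ae r2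
      filter_upwards [a1, a2] with p hp1 hp2
      exact ⟨mul_nonneg hp1.1 hp2.1, mul_le_one₀ hp1.2 hp2.1 hp2.2⟩
    · intro k
      rw [integral_map hm.aemeasurable (by fun_prop)]
      simp only [mul_pow]
      rw [integral_prod_mul (fun u : ℝ => u^k) (fun u : ℝ => u^k), h3, r3, Finset.prod_range_succ]

lemma exp_moment (μ : Measure ℝ) [IsProbabilityMeasure μ] (h : ∀ᵐ u ∂μ, u ∈ Set.Icc (0:ℝ) 1)
    (a : ℝ) : HasSum (fun k : ℕ => a ^ k / k.factorial * ∫ u, u ^ k ∂μ)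
      (∫ u, Real.exp (a * u) ∂μ) := by
  have hsum : Summable (fun k : ℕ => |a| ^ k / k.factorial) := Real.summable_pow_div_factorial _
  have := hasSum_integral_of_dominated_convergence (μ := μ)
    (F := fun (k : ℕ) u => a ^ k / k.factorial * u ^ k) (f := fun u => Real.exp (a * u))
    (fun k _ => |a| ^ k / k.factorial) (fun k => by fun_prop)
    (fun k => by
      filter_upwards [h] with u hu
      rw [norm_mul, norm_div, norm_pow, norm_pow, Real.norm_of_nonneg hu.1, Real.norm_natCast,
        Real.norm_eq_abs]
      exact mul_le_of_le_one_right (by positivity) (pow_le_one₀ hu.1 hu.2))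
    (Eventually.of_forall fun _ => hsum) (integrable_const _)
    (Eventually.of_forall fun u => by
      have := NormedSpace.expSeries_div_hasSum_exp (a * u)
      rw [← Real.exp_eq_exp_ℝ] at this
      convert! this using 1
      ext k; rw [mul_pow]; ring)
  simpa only [integral_const_mul] using this

/-- integrand -/
noncomputable def qi (α lam : ℝ) (m : ℕ) (T s : ℝ) : ℝ :=
  α * Real.exp (-α * s) * (Real.exp (-lam * (T - s)) * (1 - Real.exp (-lam * (T - s))) ^ m)

noncomputable def Qf (α lam : ℝ) (m : ℕ) (T : ℝ) : ℝ :=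
  ∑ k ∈ Finset.Icc 1 (m+1),
    (m.choose (k - 1) : ℝ) * (-1 : ℝ) ^ k * (α / ((k : ℝ) * lam - α)) *
      (Real.exp (-((k : ℝ) * lam) * T) - Real.exp (-α * T))

lemma Jint (α c T : ℝ) (hc : c ≠ α) :
    ∫ s in (0:ℝ)..T, α * Real.exp (-α * s) * Real.exp (-c * (T - s)) =
      α / (c - α) * (Real.exp (-α * T) - Real.exp (-c * T)) := by
  have hc' : c - α ≠ 0 := sub_ne_zero.2 hc
  rw [intervalIntegral.integral_eq_sub_of_hasDerivAt
    (f := fun s => α / (c - α) * (Real.exp (-α * s + -c * (T - s))))]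
  · simp; ring
  · intro s _
    have h1 : HasDerivAt (fun s : ℝ => -α * s + -c * (T - s)) (-α + c) s := by
      have := ((hasDerivAt_id s).const_mul (-α)).add
        (((hasDerivAt_id s).const_sub T).const_mul (-c))
      convert! this using 1
      ring
    have h2 := h1.exp.const_mul (α / (c - α))
    convert! h2 using 1
    rw [mul_assoc, ← Real.exp_add]
    field_simp
    ring
  · apply Continuous.intervalIntegrable
    fun_prop

lemma Qf_eq (α lam : ℝ) (hne : ∀ k : ℕ, 1 ≤ k → (k : ℝ) * lam ≠ α) (m : ℕ) (T : ℝ) :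
    Qf α lam m T = ∫ s in (0:ℝ)..T, qi α lam m T s := by
  have e : ∀ s, qi α lam m T s = ∑ j ∈ Finset.range (m+1), ((m.choose j : ℝ) * (-1)^j) *
      (α * Real.exp (-α * s) * Real.exp (-(((j+1:ℕ):ℝ) * lam) * (T - s))) := by
    intro s
    have : (1 - Real.exp (-lam * (T - s))) ^ m =
      ∑ j ∈ Finset.range (m+1), (-Real.exp (-lam * (T - s))) ^ j * (m.choose j) := by
      rw [sub_eq_add_neg, add_comm, add_pow]
      simp
    rw [qi, this, Finset.mul_sum, Finset.mul_sum]
    refine Finset.sum_congr rfl fun j _ => ?_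
    rw [neg_pow, ← Real.exp_nat_mul]
    have : Real.exp (-(((j+1:ℕ):ℝ) * lam) * (T - s)) =
      Real.exp (-lam * (T - s)) * Real.exp (j * (-lam * (T - s))) := by
      rw [← Real.exp_add]; congr 1; push_cast; ring
    rw [this]; ring
  simp only [e]
  rw [intervalIntegral.integral_finsetSum]
  · simp only [intervalIntegral.integral_const_mul]
    rw [Qf, ← Finset.Ico_add_one_right_eq_Icc, Finset.sum_Ico_eq_sum_range]
    refine Finset.sum_congr (by simp) fun j _ => ?_
    rw [Jint _ _ _ (hne (j+1) (by omega)), add_comm 1 j, pow_succ]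
    simp only [Nat.add_sub_cancel]
    ring
  · intro j _
    apply Continuous.intervalIntegrable
    fun_prop

lemma qi_nonneg (α lam : ℝ) (hα : 0 < α) (hlam : 0 < lam) (m : ℕ) (T s : ℝ) (h : s ≤ T) :
    0 ≤ qi α lam m T s := by
  have : Real.exp (-lam * (T - s)) ≤ 1 := by
    rw [Real.exp_le_one_iff]; nlinarith
  have h2 : 0 ≤ 1 - Real.exp (-lam * (T - s)) := by linarith
  rw [qi]; positivity

lemma Qf_nonneg (α lam : ℝ) (hα : 0 < α) (hlam : 0 < lam)
    (hne : ∀ k : ℕ, 1 ≤ k → (k : ℝ) * lam ≠ α) (m : ℕ) (T : ℝ) (hT : 0 ≤ T) :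
    0 ≤ Qf α lam m T := by
  rw [Qf_eq α lam hne]
  exact intervalIntegral.integral_nonneg hT fun s hs => qi_nonneg α lam hα hlam m T s hs.2

lemma hasSum_integral_nn {X : Type*} [MeasurableSpace X] {μ : Measure X} {F : ℕ → X → ℝ} {f : X → ℝ}
    (hm : ∀ n, AEStronglyMeasurable (F n) μ) (h0 : ∀ᵐ a ∂μ, ∀ n, 0 ≤ F n a)
    (hs : ∀ᵐ a ∂μ, HasSum (fun n => F n a) (f a)) (hf : Integrable f μ) :
    HasSum (fun n => ∫ a, F n a ∂μ) (∫ a, f a ∂μ) := by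
  refine hasSum_integral_of_dominated_convergence F hm ?_ (hs.mono fun a h => h.summable) ?_ hs
  · intro n
    filter_upwards [h0] with a ha
    rw [Real.norm_of_nonneg (ha n)]
  · refine hf.congr ?_
    filter_upwards [hs] with a ha
    exact ha.tsum_eq.symm

lemma Qf_hasSum (α lam : ℝ) (hα : 0 < α) (hlam : 0 < lam)
    (hne : ∀ k : ℕ, 1 ≤ k → (k : ℝ) * lam ≠ α) (r : ℕ) (T : ℝ) (hT : 0 ≤ T) :
    HasSum (fun m : ℕ => ((m + r).choose r : ℝ) * Qf α lam m T)
      (α / (α + r * lam) * (Real.exp (r * lam * T) - Real.exp (-α * T))) := by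
  have hr : (0:ℝ) ≤ r * lam := by positivity
  have e : α / (α + r * lam) * (Real.exp (r * lam * T) - Real.exp (-α * T)) =
      ∫ s in (0:ℝ)..T, α * Real.exp (-α * s) * Real.exp (-(-(r * lam)) * (T - s)) := by
    rw [Jint _ _ _ (by linarith), neg_neg]
    have : -(r * lam) - α = - (α + r * lam) := by ring
    rw [this, div_neg]; ring
  rw [e]
  simp only [Qf_eq α lam hne, ← intervalIntegral.integral_const_mul]
  simp only [intervalIntegral.integral_of_le hT]
  apply hasSum_integral_nn
  · intro m
    apply Continuous.aestronglyMeasurable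
    unfold qi
    fun_prop
  · refine (ae_restrict_iff' measurableSet_Ioc).2 (Eventually.of_forall fun s hs n => ?_)
    exact mul_nonneg (by positivity) (qi_nonneg α lam hα hlam n T s hs.2)
  · refine (ae_restrict_iff' measurableSet_Ioc).2 (Eventually.of_forall fun s hs => ?_)
    have h1 : Real.exp (-lam * (T - s)) ≤ 1 := by
      rw [Real.exp_le_one_iff]; nlinarith [hs.2]
    have h2 := Real.exp_pos (-lam * (T - s))
    have := hasSum_choose_mul_geometric_of_norm_lt_one r (r := 1 - Real.exp (-lam * (T - s)))
      (by rw [Real.norm_of_nonneg (by linarith)]; linarith)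
    have := this.mul_left (α * Real.exp (-α * s) * Real.exp (-lam * (T - s)))
    convert! this using 1
    · ext m; rw [qi]; ring
    · rw [sub_sub_cancel, pow_succ, ← Real.exp_nat_mul]
      have : Real.exp (-(-(r * lam)) * (T - s)) = (Real.exp (r * (-lam * (T - s))))⁻¹ := by
        rw [← Real.exp_neg]; congr 1; ring
      rw [this]
      field_simp
  · apply Continuous.integrableOn_Ioc
    fun_prop

lemma G_tendsto (ν : ℝ) (hν : 0 < ν) (hν1 : ν ≤ 1) (μ : ℕ → Measure ℝ)
    (h1 : ∀ N, IsProbabilityMeasure (μ N)) (h2 : ∀ N, ∀ᵐ u ∂(μ N), u ∈ Set.Icc (0:ℝ) 1)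
    (h3 : ∀ N k, ∫ u, u ^ k ∂(μ N) = mom ν N k) (c x : ℝ) :
    Tendsto (fun N : ℕ => ∫ u, Real.exp (c * (x * (N:ℝ) ^ (1-ν) * u)) ∂(μ N)) atTop
      (𝓝 (ML ν (c * x))) := by
  have e : ∀ N : ℕ, ∫ u, Real.exp (c * (x * (N:ℝ) ^ (1-ν) * u)) ∂(μ N) =
      ∑' k : ℕ, (c * x) ^ k * (((N:ℝ) ^ (1-ν)) ^ k * mom ν N k / k.factorial) := by
    intro N
    have := exp_moment (μ N) (h2 N) (c * x * (N:ℝ) ^ (1-ν))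
    have e : ∀ u : ℝ, c * (x * (N:ℝ) ^ (1-ν) * u) = c * x * (N:ℝ) ^ (1-ν) * u := fun u => by ring
    simp only [e]
    rw [← this.tsum_eq]
    refine tsum_congr fun k => ?_
    rw [h3, mul_pow (c * x)]; ring
  simp only [e, ML]
  refine tendsto_tsum_of_dominated_convergence
    (bound := fun k : ℕ => |c * x| ^ k / Real.Gamma ((k:ℝ) * ν + 1)) (ml_summable ν hν _) ?_ ?_
  · intro k
    have := (mom_tendsto ν hν k).const_mul ((c * x) ^ k)
    rwa [mul_one_div] at this
  · refine Eventually.of_forall fun N k => ?_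
    have hm : 0 ≤ mom ν N k := Finset.prod_nonneg fun j _ => by positivity
    rw [norm_mul, norm_pow, Real.norm_eq_abs, Real.norm_of_nonneg (by positivity),
      ← mul_one_div (|c * x| ^ k)]
    exact mul_le_mul_of_nonneg_left (mom_bound ν hν hν1 N k) (by positivity)

lemma pbar_hasSum (ν α lam : ℝ) (hν0 : 0 < ν) (hν1 : ν ≤ 1) (hα : 0 < α)
    (hlam : 0 < lam) (hne : ∀ k : ℕ, 1 ≤ k → (k : ℝ) * lam ≠ α) (t : ℝ) (ht : 0 ≤ t)
    (r : ℕ) (hr : ∀ m : ℕ, ((m + r).choose r : ℝ) ≤ ((m:ℝ)+1)^2) :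
    HasSum (fun m : ℕ => ((m + r).choose r : ℝ) * pbar ν α lam (m+1) t)
      (α / (α + r * lam) * (ML ν (r * lam * t ^ ν) - ML ν (-α * t ^ ν))) := by
  choose μ h1 h2 h3 using fun N => mu_exists ν hν0 hν1 (N+1)
  have hx : 0 ≤ t ^ ν := Real.rpow_nonneg ht _
  set x := t ^ ν with hxdef
  have hG := fun c => G_tendsto ν hν0 hν1 μ h1 h2 h3 c x
  have hint : ∀ (N : ℕ) (c : ℝ), Integrable
      (fun u => Real.exp (c * (x * (N:ℝ) ^ (1-ν) * u))) (μ N) := by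
    intro N c
    refine Integrable.of_bound (C := Real.exp (|c * (x * (N:ℝ) ^ (1-ν))|)) (by fun_prop) ?_
    filter_upwards [h2 N] with u hu
    rw [Real.norm_of_nonneg (Real.exp_pos _).le, Real.exp_le_exp, ← mul_assoc]
    refine (le_abs_self _).trans ?_
    rw [abs_mul, abs_of_nonneg hu.1]
    exact mul_le_of_le_one_right (abs_nonneg _) hu.2
  set G : ℕ → ℝ → ℝ := fun N c => ∫ u, Real.exp (c * (x * (N:ℝ) ^ (1-ν) * u)) ∂(μ N) with hGdef
  let P : ℕ → ℕ → ℝ := fun N m => ∫ u, Qf α lam m (x * (N:ℝ) ^ (1-ν) * u) ∂(μ N)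
  have hP : ∀ N m, P N m = ∑ k ∈ Finset.Icc 1 (m+1),
    (m.choose (k - 1) : ℝ) * (-1 : ℝ) ^ k * (α / ((k : ℝ) * lam - α)) *
      (G N (-((k : ℝ) * lam)) - G N (-α)) := by
    intro N m
    simp only [P, Qf]
    rw [integral_finsetSum]
    · refine Finset.sum_congr rfl fun k _ => ?_
      rw [integral_const_mul, integral_sub (hint N _) (hint N _)]
    · intro k _
      exact ((hint N _).sub (hint N _)).const_mul _
  have hPlim : ∀ m, Tendsto (fun N => P N m) atTop (𝓝 (pbar ν α lam (m+1) t)) := by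
    intro m
    simp only [hP, pbar, Nat.add_one_ne_zero, if_false, Nat.add_sub_cancel]
    exact tendsto_finsetSum _ fun k _ => ((hG _).sub (hG _)).const_mul _
  have hT : ∀ N : ℕ, ∀ᵐ u ∂(μ N), 0 ≤ x * (N:ℝ) ^ (1-ν) * u := by
    intro N
    filter_upwards [h2 N] with u hu
    have := hu.1
    positivity
  have hP0 : ∀ N m, 0 ≤ P N m := fun N m => integral_nonneg_of_ae (by
    filter_upwards [hT N] with u hu
    exact Qf_nonneg α lam hα hlam hne m _ hu)
  have hPS : ∀ (r N : ℕ), HasSum (fun m : ℕ => ((m + r).choose r : ℝ) * P N m)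
      (α / (α + r * lam) * (G N (r * lam) - G N (-α))) := by
    intro r N
    have e : α / (α + r * lam) * (G N (r * lam) - G N (-α)) =
        ∫ u, α / (α + r * lam) * (Real.exp (r * lam * (x * (N:ℝ) ^ (1-ν) * u))
          - Real.exp (-α * (x * (N:ℝ) ^ (1-ν) * u))) ∂(μ N) := by
      rw [integral_const_mul, integral_sub (hint N _) (hint N _)]
    rw [e]
    simp only [P, ← integral_const_mul]
    apply hasSum_integral_nn
    · intro m
      apply Continuous.aestronglyMeasurable
      unfold Qf
      fun_prop
    · filter_upwards [hT N] with u hu m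
      exact mul_nonneg (by positivity) (Qf_nonneg α lam hα hlam hne m _ hu)
    · filter_upwards [hT N] with u hu
      exact Qf_hasSum α lam hα hlam hne r _ hu
    · exact ((hint N _).sub (hint N _)).const_mul _
  have hlimS : ∀ r : ℕ, Tendsto (fun N => α / (α + r * lam) * (G N (r * lam) - G N (-α))) atTop
      (𝓝 (α / (α + r * lam) * (ML ν (r * lam * x) - ML ν (-α * x)))) := fun r =>
    ((hG _).sub (hG _)).const_mul _
  obtain ⟨K, hK⟩ := (hlimS 4).bddAbove_range
  have hK' : ∀ N m, ((m + 4).choose 4 : ℝ) * P N m ≤ K := fun N m =>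
    (le_hasSum (hPS 4 N) m fun j _ => mul_nonneg (by positivity) (hP0 N j)).trans
      (hK ⟨N, rfl⟩)
  have hK0 : 0 ≤ K := (mul_nonneg (by positivity) (hP0 0 0)).trans (hK' 0 0)
  have hch : ∀ m : ℕ, ((m:ℝ)+1)^4 ≤ 24 * ((m + 4).choose 4 : ℝ) := by
    intro m
    have h := Nat.pow_succ_le_ascFactorial (m+1) 4
    have h' : (m+1).ascFactorial 4 = 24 * (m+4).choose 4 := by
      rw [Nat.ascFactorial_eq_factorial_mul_choose]
      rfl
    rw [h'] at h
    exact_mod_cast h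
  have hbd : ∀ N m, ((m + r).choose r : ℝ) * P N m ≤ 24 * K * (1 / ((m:ℝ)+1)^2) := by
    intro N m
    have a := hK' N m
    have b := mul_le_mul_of_nonneg_right (hr m) (hP0 N m)
    have c := mul_le_mul_of_nonneg_right (hch m) (hP0 N m)
    refine b.trans ?_
    rw [mul_one_div, le_div_iff₀ (by positivity)]
    nlinarith
  have hbs : Summable (fun m : ℕ => 24 * K * (1 / ((m:ℝ)+1)^2)) := by
    apply Summable.mul_left
    have := (summable_nat_add_iff 1).2 (Real.summable_one_div_nat_pow.2 (one_lt_two))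
    simpa using this
  have hT1 := tendsto_tsum_of_dominated_convergence (𝓕 := atTop)
    (f := fun N m => ((m + r).choose r : ℝ) * P N m)
    (g := fun m => ((m + r).choose r : ℝ) * pbar ν α lam (m+1) t) hbs
    (fun m => (hPlim m).const_mul _)
    (Eventually.of_forall fun N m => by
      rw [Real.norm_of_nonneg (mul_nonneg (by positivity) (hP0 N m))]
      exact hbd N m)
  simp only [(hPS r _).tsum_eq] at hT1
  have heq := tendsto_nhds_unique hT1 (hlimS r)
  rw [← heq]
  apply Summable.hasSum
  refine Summable.of_nonneg_of_le (fun m => ?_) (fun m => ?_) hbs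
  · exact mul_nonneg (by positivity) (ge_of_tendsto' (hPlim m) fun N => hP0 N m)
  · exact le_of_tendsto' ((hPlim m).const_mul _) fun N => hbd N m

/-- Variance of the TFLBPwI. -/
theorem pbar_variance (ν α lam : ℝ) (hν0 : 0 < ν) (hν1 : ν ≤ 1) (hα : 0 < α)
    (hlam : 0 < lam) (hne : ∀ k : ℕ, 1 ≤ k → (k : ℝ) * lam ≠ α) (t : ℝ) (ht : 0 ≤ t) :
    (∑' n : ℕ, (n : ℝ) ^ 2 * pbar ν α lam n t) -
        (∑' n : ℕ, (n : ℝ) * pbar ν α lam n t) ^ 2 =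
      2 * α * ML ν (2 * lam * t ^ ν) / (α + 2 * lam)
        - α * ML ν (lam * t ^ ν) / (α + lam)
        - α ^ 2 * ML ν (-α * t ^ ν) / ((α + lam) * (α + 2 * lam))
        - (α / (α + lam)) ^ 2 * (ML ν (lam * t ^ ν) - ML ν (-α * t ^ ν)) ^ 2 := by
  have H1 := pbar_hasSum ν α lam hν0 hν1 hα hlam hne t ht 1 (fun m => by
    simp; nlinarith [(Nat.cast_nonneg m : (0:ℝ) ≤ m)])
  have hc2 : ∀ m : ℕ, ((m + 2).choose 2 : ℝ) = ((m:ℝ)+1) * (m+2) / 2 := by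
    intro m
    rw [Nat.cast_choose_two]; push_cast; ring
  have H2 := pbar_hasSum ν α lam hν0 hν1 hα hlam hne t ht 2 (fun m => by
    rw [hc2]; nlinarith [(Nat.cast_nonneg m : (0:ℝ) ≤ m)])
  have S1 : HasSum (fun n : ℕ => (n : ℝ) * pbar ν α lam n t)
      (α / (α + lam) * (ML ν (lam * t ^ ν) - ML ν (-α * t ^ ν))) := by
    rw [← hasSum_nat_add_iff' 1]
    simpa using H1
  have S2 : HasSum (fun n : ℕ => (n : ℝ) ^ 2 * pbar ν α lam n t)
      (2 * (α / (α + 2 * lam) * (ML ν (2 * lam * t ^ ν) - ML ν (-α * t ^ ν))) -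
        α / (α + lam) * (ML ν (lam * t ^ ν) - ML ν (-α * t ^ ν))) := by
    rw [← hasSum_nat_add_iff' 1]
    have := (H2.mul_left 2).sub H1
    convert! this using 1
    · ext m; rw [hc2]; push_cast; simp; ring
    · simp
  rw [S1.tsum_eq, S2.tsum_eq]
  field_simp
  ring
end

section
/- Fix 0<ν≤1, λ>0, t≥0 and an integer n≥1, and for α>0 with kλ≠α for all positive integers k write p̄_α(n,t) for the n-th state probability of the TFLBPwI with immigration rate α. Then lim_{α→0⁺} p̄_α(n,t)/α = (1/(nλ)) ∑_{k=0}^{n} C(n,k) (−1)^k E_ν(−kλ t^ν). -/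
open MeasureTheory

theorem gamma_lower : ∃ c : ℝ, 0 < c ∧ ∀ x : ℝ, 1 ≤ x → c ≤ Real.Gamma x := by
  have hc : ContinuousOn Real.Gamma (Set.Icc 1 2) := by
    intro x hx
    apply ContinuousAt.continuousWithinAt
    apply DifferentiableAt.continuousAt (𝕜 := ℝ)
    apply Real.differentiableAt_Gamma
    intro m hm
    have : (0 : ℝ) ≤ m := Nat.cast_nonneg m
    linarith [hx.1]
  obtain ⟨y, hy, hmin⟩ := isCompact_Icc.exists_isMinOn (Set.nonempty_Icc.2 (by norm_num)) hc
  have hy0 : 0 < Real.Gamma y := Real.Gamma_pos_of_pos (by linarith [hy.1])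
  refine ⟨Real.Gamma y, hy0, fun x hx => ?_⟩
  rcases le_total x 2 with h | h
  · exact hmin ⟨hx, h⟩
  · exact (hmin (show (2 : ℝ) ∈ Set.Icc (1 : ℝ) 2 by constructor <;> norm_num)).trans
      (Real.Gamma_strictMonoOn_Ici.monotoneOn (Set.mem_Ici.2 le_rfl) (Set.mem_Ici.2 h) h)

theorem ML_zero (ν : ℝ) : ML ν 0 = 1 := by
  unfold ML
  rw [tsum_eq_single 0]
  · simp
  · intro k hk
    simp [hk]

theorem ML_cont (ν : ℝ) (hν : 0 < ν) : ContinuousAt (ML ν) 0 := by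
  obtain ⟨c, hc, hG⟩ := gamma_lower
  have h : ContinuousOn (ML ν) (Set.Icc (-(1/2)) (1/2)) := by
    unfold ML
    apply continuousOn_tsum (u := fun k : ℕ => (1/2 : ℝ) ^ k / c)
    · intro k
      fun_prop
    · exact (summable_geometric_of_lt_one (by norm_num) (by norm_num)).div_const c
    · intro k x hx
      have hg := hG ((k : ℝ) * ν + 1) (by nlinarith [(Nat.cast_nonneg k : (0:ℝ) ≤ k)])
      rw [norm_div, norm_pow, Real.norm_eq_abs, Real.norm_eq_abs,
        abs_of_pos (hc.trans_le hg)]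
      have : |x| ≤ 1/2 := abs_le.2 hx
      gcongr
  exact h.continuousAt (Icc_mem_nhds (by norm_num) (by norm_num))

theorem pbar_small_immigration_limit (ν lam : ℝ) (hν0 : 0 < ν) (hν1 : ν ≤ 1)
    (hlam : 0 < lam) (t : ℝ) (ht : 0 ≤ t) (n : ℕ) (hn : 1 ≤ n) :
    Filter.Tendsto (fun α : ℝ => pbar ν α lam n t / α) (nhdsWithin 0 (Set.Ioi 0))
      (nhds ((1 / ((n : ℝ) * lam)) * ∑ k ∈ Finset.range (n + 1),
        (n.choose k : ℝ) * (-1 : ℝ) ^ k * ML ν (-((k : ℝ) * lam) * t ^ ν))) := by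
  have hlim : Filter.Tendsto (fun α : ℝ => ML ν (-α * t ^ ν)) (nhds 0) (nhds 1) := by
    have h1 : Filter.Tendsto (fun α : ℝ => -α * t ^ ν) (nhds 0) (nhds 0) := by
      have : Continuous (fun α : ℝ => -α * t ^ ν) := by fun_prop
      simpa using this.tendsto 0
    have h2 := (ML_cont ν hν0).tendsto
    rw [ML_zero] at h2
    exact h2.comp h1
  have key : Filter.Tendsto (fun α : ℝ => ∑ k ∈ Finset.Icc 1 n,
      ((n - 1).choose (k - 1) : ℝ) * (-1 : ℝ) ^ k * (1 / ((k : ℝ) * lam - α)) *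
      (ML ν (-((k : ℝ) * lam) * t ^ ν) - ML ν (-α * t ^ ν))) (nhds 0)
      (nhds (∑ k ∈ Finset.Icc 1 n,
      ((n - 1).choose (k - 1) : ℝ) * (-1 : ℝ) ^ k * (1 / ((k : ℝ) * lam - 0)) *
      (ML ν (-((k : ℝ) * lam) * t ^ ν) - 1))) := by
    apply tendsto_finsetSum
    intro k hk
    have hk1 : (0 : ℝ) < k := by exact_mod_cast (Finset.mem_Icc.1 hk).1
    refine Filter.Tendsto.mul (Filter.Tendsto.mul tendsto_const_nhds ?_)
      (tendsto_const_nhds.sub hlim)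
    refine Filter.Tendsto.div tendsto_const_nhds
      (tendsto_const_nhds.sub Filter.tendsto_id) ?_
    rw [sub_zero]
    positivity
  have hval : (1 / ((n : ℝ) * lam)) * ∑ k ∈ Finset.range (n + 1),
        (n.choose k : ℝ) * (-1 : ℝ) ^ k * ML ν (-((k : ℝ) * lam) * t ^ ν) =
      ∑ k ∈ Finset.Icc 1 n,
      ((n - 1).choose (k - 1) : ℝ) * (-1 : ℝ) ^ k * (1 / ((k : ℝ) * lam - 0)) *
      (ML ν (-((k : ℝ) * lam) * t ^ ν) - 1) := by
    have halt : ∑ k ∈ Finset.range (n + 1), (n.choose k : ℝ) * (-1 : ℝ) ^ k = 0 := by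
      have := Int.alternating_sum_range_choose_of_ne (n := n) (by omega)
      have h2 := congrArg (Int.cast : ℤ → ℝ) this
      push_cast at h2
      rw [← h2]
      exact Finset.sum_congr rfl fun k _ => mul_comm _ _
    have h1 : ∑ k ∈ Finset.range (n + 1),
        (n.choose k : ℝ) * (-1 : ℝ) ^ k * ML ν (-((k : ℝ) * lam) * t ^ ν) =
        ∑ k ∈ Finset.range (n + 1),
        (n.choose k : ℝ) * (-1 : ℝ) ^ k * (ML ν (-((k : ℝ) * lam) * t ^ ν) - 1) := by
      simp only [mul_sub, mul_one, Finset.sum_sub_distrib, halt, sub_zero]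
    have hIcc : Finset.Icc 1 n = Finset.Ico 1 (n + 1) := by
      ext k; simp only [Finset.mem_Icc, Finset.mem_Ico]; omega
    rw [h1, hIcc, Finset.sum_Ico_eq_sum_range, Finset.sum_range_succ']
    obtain ⟨m, rfl⟩ : ∃ m, n = m + 1 := ⟨n - 1, by omega⟩
    simp only [Nat.cast_zero, zero_mul, neg_zero, ML_zero, sub_self, mul_zero, add_zero,
      Nat.add_sub_cancel, Nat.add_sub_cancel_left, sub_zero]
    rw [Finset.mul_sum]
    refine Finset.sum_congr rfl fun k _ => ?_
    have hch : ((m : ℝ) + 1) * (m.choose k : ℝ) = ((m + 1).choose (k + 1) : ℝ) * ((k : ℝ) + 1) := by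
      exact_mod_cast Nat.add_one_mul_choose_eq m k
    have hch' : (m.choose k : ℝ) =
        ((m + 1).choose (k + 1) : ℝ) * ((k : ℝ) + 1) / ((m : ℝ) + 1) := by
      rw [eq_div_iff (by positivity), ← hch]; ring
    rw [hch', add_comm 1 k]
    push_cast
    have : (k : ℝ) + 1 ≠ 0 := by positivity
    have : (m : ℝ) + 1 ≠ 0 := by positivity
    field_simp
  rw [hval]
  refine (key.mono_left nhdsWithin_le_nhds).congr' ?_
  filter_upwards [self_mem_nhdsWithin] with α hα
  have hα' : α ≠ 0 := ne_of_gt hα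
  rw [pbar, if_neg (by omega), Finset.sum_div]
  refine Finset.sum_congr rfl fun k _ => ?_
  rw [show α / ((k : ℝ) * lam - α) = α * (1 / ((k : ℝ) * lam - α)) by ring, eq_div_iff hα']
  ring
end
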